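/- On a properly infinite von Neumann algebra R, a state is maximally mixed if and only if it vanishes on the strong radical J_R of R. -/

import Mathlib

universe u

open scoped ComplexConjugate ComplexOrder

noncomputable section

variable {H : Type u} [NormedAddCommGroup H] [InnerProductSpace ℂ H] [CompleteSpace H]

local notation "⟪" x ", " y "⟫" => @inner ℂ _ _ x y

namespace VonNeumannAlgebraPaper

/-- Scalar multiples of elements of a von Neumann algebra stay in it. -/
instance : SMulMemClass (VonNeumannAlgebra H) ℂ (H →L[ℂ] H) where
  smul_mem {S} z x hx := by
    have h : z • x = algebraMap ℂ (H →L[ℂ] H) z * x := Algebra.smul_def z x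
    rw [h]
    exact mul_mem (S.toStarSubalgebra.algebraMap_mem z) hx

instance (M : VonNeumannAlgebra H) : Algebra ℂ ↥M :=
  Algebra.ofModule
    (fun r x y => Subtype.ext (smul_mul_assoc r (x : H →L[ℂ] H) (y : H →L[ℂ] H)))
    (fun r x y => Subtype.ext (mul_smul_comm r (x : H →L[ℂ] H) (y : H →L[ℂ] H)))

instance (M : VonNeumannAlgebra H) : NormedAlgebra ℂ ↥M where
  norm_smul_le r x := norm_smul_le r (x : H →L[ℂ] H)

variable {M : VonNeumannAlgebra H}

/-- A linear functional on `M` is positive if it is nonnegative on all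
elements `a* a`. -/
def IsPositiveFunctional (ω : ↥M →L[ℂ] ℂ) : Prop :=
  ∀ a : ↥M, 0 ≤ ω (star a * a)

/-- A state is a positive unital linear functional. -/
def IsState (ω : ↥M →L[ℂ] ℂ) : Prop :=
  IsPositiveFunctional ω ∧ ω 1 = 1

/-- A hermitian (self-adjoint) linear functional. -/
def IsHermitianFunctional (ω : ↥M →L[ℂ] ℂ) : Prop :=
  ∀ a : ↥M, ω (star a) = conj (ω a)

/-- `ωp`, `ωm` form the Jordan decomposition of the hermitian functional `ω`. -/
def IsJordanDecomposition (ω ωp ωm : ↥M →L[ℂ] ℂ) : Prop :=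
  IsPositiveFunctional ωp ∧ IsPositiveFunctional ωm ∧ ω = ωp - ωm ∧ ‖ω‖ = ‖ωp‖ + ‖ωm‖

/-- An element of a C*-algebra is positive iff it is of the form `b* b`. -/
def IsPositiveElem (c : ↥M) : Prop :=
  ∃ b : ↥M, c = star b * b

/-- A normal (= weak* continuous) functional on the von Neumann algebra `M`:
it is given by a pair of ℓ²-sequences of vectors. -/
def IsNormalFunctional (ω : ↥M →L[ℂ] ℂ) : Prop :=
  ∃ x y : ℕ → H, Summable (fun n => ‖x n‖ ^ 2) ∧ Summable (fun n => ‖y n‖ ^ 2) ∧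
    ∀ a : ↥M, HasSum (fun n => ⟪x n, (a : H →L[ℂ] H) (y n)⟫) (ω a)

/-- `E(M)`: the unital completely positive elementary maps
`x ↦ ∑ i, (a i)* x (a i)` with `∑ i, (a i)* (a i) = 1`. -/
def IsElementaryUCP (φ : ↥M →L[ℂ] ↥M) : Prop :=
  ∃ (n : ℕ) (a : Fin n → ↥M), (∑ i, star (a i) * a i) = 1 ∧
    ∀ x : ↥M, φ x = ∑ i, star (a i) * x * a i

/-- The set `ω ∘ E(M) = {ω ∘ φ : φ ∈ E(M)}`. -/
def mixSet (ω : ↥M →L[ℂ] ℂ) : Set (↥M →L[ℂ] ℂ) :=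
  {ρ | ∃ φ : ↥M →L[ℂ] ↥M, IsElementaryUCP φ ∧ ρ = ω.comp φ}

/-- Membership in the weak* closure of a set of functionals on `M`. -/
def InWeakStarClosure (S : Set (↥M →L[ℂ] ℂ)) (ρ : ↥M →L[ℂ] ℂ) : Prop :=
  ∀ ε : ℝ, 0 < ε → ∀ (n : ℕ) (x : Fin n → ↥M), ∃ σ ∈ S, ∀ i, ‖ρ (x i) - σ (x i)‖ < ε

/-- Membership in the point-weak* closure of a set `S` of maps on `M`: at
finitely many points, finitely many normal functionals are simultaneously
approximated by some member of `S`. -/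
def InPointWeakStarClosure (S : Set (↥M →L[ℂ] ↥M)) (ψ : ↥M →L[ℂ] ↥M) : Prop :=
  ∀ ε : ℝ, 0 < ε → ∀ (n : ℕ) (x : Fin n → ↥M) (g : Fin n → (↥M →L[ℂ] ℂ)),
    (∀ i, IsNormalFunctional (g i)) →
    ∃ φ ∈ S, ∀ i j, ‖g i (ψ (x j)) - g i (φ (x j))‖ < ε

/-- A map on `M` is normal if pre-composition preserves normal functionals. -/
def IsNormalMap (ψ : ↥M →L[ℂ] ↥M) : Prop :=
  ∀ ω : ↥M →L[ℂ] ℂ, IsNormalFunctional ω → IsNormalFunctional (ω.comp ψ)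

/-- Complete positivity of a map on `M`. -/
def IsCompletelyPositiveMap (ψ : ↥M →L[ℂ] ↥M) : Prop :=
  ∀ (n : ℕ) (a : Fin n → ↥M) (v : Fin n → H),
    0 ≤ ∑ i, ∑ j, ⟪v i, ((ψ (star (a i) * a j) : ↥M) : H →L[ℂ] H) (v j)⟫

/-- The norm `‖cω‖` of the functional `x ↦ ω (c * x)`. -/
def mulNorm (ω : ↥M →L[ℂ] ℂ) (c : ↥M) : ℝ :=
  sSup {r : ℝ | ∃ x : ↥M, ‖x‖ ≤ 1 ∧ r = ‖ω (c * x)‖}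

/-- Norm-closed two-sided ideals of `M`. -/
def IsClosedIdeal (J : Set ↥M) : Prop :=
  IsClosed J ∧ (0 : ↥M) ∈ J ∧ (∀ x ∈ J, ∀ y ∈ J, x + y ∈ J) ∧
    (∀ (c : ℂ), ∀ x ∈ J, c • x ∈ J) ∧ (∀ (a : ↥M), ∀ x ∈ J, a * x ∈ J ∧ x * a ∈ J)

/-- The norm `‖ω|J‖` of the restriction of a functional `ω` to a subset `J`. -/
def normRestrict (ω : ↥M →L[ℂ] ℂ) (J : Set ↥M) : ℝ :=
  sSup {r : ℝ | ∃ x ∈ J, ‖x‖ ≤ 1 ∧ r = ‖ω x‖}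

/-- Maximal (norm-closed two-sided) ideals of `M`. -/
def IsMaximalIdeal (N : Set ↥M) : Prop :=
  IsClosedIdeal N ∧ N ≠ Set.univ ∧
    ∀ N' : Set ↥M, IsClosedIdeal N' → N' ≠ Set.univ → N ⊆ N' → N' = N

/-- The strong radical of `M`: the intersection of all maximal ideals. -/
def strongRadical (M : VonNeumannAlgebra H) : Set ↥M :=
  ⋂₀ {N : Set ↥M | IsMaximalIdeal N}

/-- A state `ω` is maximally mixed if every state `ρ` in the weak* closure of
`ω ∘ E(M)` satisfies in turn that `ω` is in the weak* closure of `ρ ∘ E(M)`. -/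
def IsMaximallyMixed (ω : ↥M →L[ℂ] ℂ) : Prop :=
  IsState ω ∧ ∀ ρ : ↥M →L[ℂ] ℂ, IsState ρ →
    InWeakStarClosure (mixSet ω) ρ → InWeakStarClosure (mixSet ρ) ω

/-- `p` is a central projection of `M`. -/
def IsCentralProjection (p : ↥M) : Prop :=
  p ∈ Set.center ↥M ∧ IsSelfAdjoint p ∧ IsIdempotentElem p

/-- A projection `p` is finite if it is not Murray–von Neumann equivalent to a
proper subprojection of itself. -/
def IsFiniteProjection (p : ↥M) : Prop :=
  IsSelfAdjoint p ∧ IsIdempotentElem p ∧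
    ∀ v : ↥M, star v * v = p → p * (v * star v) = v * star v → v * star v = p

/-- `M` is properly infinite: it contains no nonzero finite central
projection. -/
def ProperlyInfinite (M : VonNeumannAlgebra H) : Prop :=
  ∀ p : ↥M, IsCentralProjection p → IsFiniteProjection p → p = 0

/-- An ideal of the center `Z` of `M` (a norm-closed subspace of the center,
stable under multiplication by central elements). -/
def IsCenterIdeal (t : Set ↥M) : Prop :=
  t ⊆ Set.center ↥M ∧ IsClosed t ∧ (0 : ↥M) ∈ t ∧
    (∀ x ∈ t, ∀ y ∈ t, x + y ∈ t) ∧ (∀ (c : ℂ), ∀ x ∈ t, c • x ∈ t) ∧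
    ∀ z ∈ Set.center ↥M, ∀ x ∈ t, z * x ∈ t

/-- A maximal ideal of the center `Z` of `M`, i.e. a point of the maximal ideal
space `Δ` of `Z`. -/
def IsMaxCenterIdeal (t : Set ↥M) : Prop :=
  IsCenterIdeal t ∧ t ≠ Set.center ↥M ∧
    ∀ s : Set ↥M, IsCenterIdeal s → s ≠ Set.center ↥M → t ⊆ s → s = t

section Abstract
set_option linter.unusedSectionVars false
open Filter Topology

/-- Abstract version of the vector functionals `x ↦ ⟪ξ, x η⟫` on a von Neumann algebra. -/
structure VecFun (A : Type*) [CStarAlgebra A] [PartialOrder A] where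
  V : Set (A → ℂ)
  sep : ∀ x y : A, (∀ ψ ∈ V, ψ x = ψ y) → x = y
  mulL : ∀ ψ ∈ V, ∀ a : A, (fun x => ψ (a * x)) ∈ V
  mulR : ∀ ψ ∈ V, ∀ a : A, (fun x => ψ (x * a)) ∈ V
  star' : ∀ ψ ∈ V, (fun x => conj (ψ (star x))) ∈ V
  cont : ∀ ψ ∈ V, Continuous ψ
  pos : ∀ y : A, (∀ ψ ∈ V, (∀ a : A, 0 ≤ a → 0 ≤ ψ a) → 0 ≤ ψ y) → 0 ≤ y
  cpt : ∀ (U : Ultrafilter A) (r : ℝ), (∀ᶠ a in (U : Filter A), ‖a‖ ≤ r) →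
    ∃ y : A, ∀ ψ ∈ V, Tendsto ψ U (𝓝 (ψ y))

variable {A : Type*} [CStarAlgebra A] [PartialOrder A] [StarOrderedRing A]

/-- Weak limits. -/
def WLim (W : VecFun A) {ι : Type*} (F : Filter ι) (f : ι → A) (y : A) : Prop :=
  ∀ ψ ∈ W.V, Tendsto (fun i => ψ (f i)) F (𝓝 (ψ y))

variable {W : VecFun A} {ι : Type*} {F : Filter ι} {f g : ι → A} {y z : A}

theorem WLim.unique [NeBot F] (h : WLim W F f y) (h' : WLim W F f z) : y = z :=
  W.sep _ _ fun ψ hψ => tendsto_nhds_unique (h ψ hψ) (h' ψ hψ)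

theorem WLim.const (y : A) : WLim W F (fun _ => y) y := fun _ _ => tendsto_const_nhds

theorem WLim.mulL (h : WLim W F f y) (a : A) : WLim W F (fun i => a * f i) (a * y) :=
  fun ψ hψ => h _ (W.mulL ψ hψ a)

theorem WLim.mulR (h : WLim W F f y) (a : A) : WLim W F (fun i => f i * a) (y * a) :=
  fun ψ hψ => h _ (W.mulR ψ hψ a)

theorem WLim.star (h : WLim W F f y) : WLim W F (fun i => star (f i)) (star y) := by
  intro ψ hψ
  have := h _ (W.star' ψ hψ)
  have h2 := (Complex.continuous_conj.tendsto _).comp this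
  simpa [Function.comp_def] using h2

theorem WLim.congr (h : WLim W F f y) (hfg : ∀ᶠ i in F, f i = g i) : WLim W F g y :=
  fun ψ hψ => (h ψ hψ).congr' (hfg.mono fun i hi => by rw [hi])

theorem WLim.of_tendsto (h : Tendsto f F (𝓝 y)) : WLim W F f y :=
  fun ψ hψ => ((W.cont ψ hψ).tendsto _).comp h

theorem WLim.eq_of_eventually [NeBot F] (h : WLim W F f y) (h' : ∀ᶠ i in F, f i = z) : y = z :=
  (h.congr h').unique (WLim.const z)

theorem WLim.nonneg [NeBot F] (h : WLim W F f y) (h' : ∀ i, 0 ≤ f i) : 0 ≤ y :=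
  W.pos y fun ψ hψ hp => ge_of_tendsto (h ψ hψ) (Eventually.of_forall fun i => hp _ (h' i))

theorem WLim.exists (W : VecFun A) (U : Ultrafilter ι) (f : ι → A) (r : ℝ) (h : ∀ i, ‖f i‖ ≤ r) :
    ∃ y, WLim W (U : Filter ι) f y := by
  obtain ⟨y, hy⟩ := W.cpt (U.map f) r (by
    simp only [Ultrafilter.coe_map, eventually_map]
    exact Eventually.of_forall h)
  exact ⟨y, fun ψ hψ => by
    have := hy ψ hψ
    rw [Ultrafilter.coe_map, tendsto_map'_iff] at this
    exact this⟩

/-- C*-cancellation. -/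
theorem star_mul_self_zero {x : A} (h : star x * x = 0) : x = 0 :=
  (CStarRing.star_mul_self_eq_zero_iff x).1 h

/-- self-adjoint projections -/
def Proj (p : A) : Prop := star p = p ∧ p * p = p

def Cent (c : A) : Prop := ∀ a, c * a = a * c

theorem Proj.compl {p : A} (h : Proj p) : Proj (1 - p) :=
  ⟨by simp [h.1], by rw [mul_sub, sub_mul, sub_mul]; simp [h.2]⟩

theorem Proj.ss {v : A} (h : (star v * v) * (star v * v) = star v * v) : Proj (star v * v) :=
  ⟨by simp, h⟩

theorem mul_of_star_mul {v e : A} (h : star v * v = e) (he : e * e = e) : v * e = v := by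
  have hse : star e = e := by rw [← h]; simp
  have : v * (1 - e) = 0 := by
    apply star_mul_self_zero
    have : star (v * (1 - e)) * (v * (1 - e)) = (1 - e) * (star v * v) * (1 - e) := by
      simp [hse, mul_assoc]
    rw [this, h, sub_mul, he]; simp
  rw [mul_sub, mul_one, sub_eq_zero] at this
  exact this.symm

end Abstract

section Abstract
set_option linter.unusedSectionVars false
open Filter Topology
variable {A : Type*} [CStarAlgebra A] [PartialOrder A] [StarOrderedRing A]

/-- approximate inverse square root -/
def gfun (d t : ℝ) : ℝ := (√(|t| + d))⁻¹

theorem gfun_cont {d : ℝ} (hd : 0 < d) : Continuous (gfun d) := by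
  unfold gfun
  refine Continuous.inv₀ (by fun_prop) fun t => ?_
  have : 0 < |t| + d := by positivity
  exact (Real.sqrt_pos.2 this).ne'

theorem gfun_a {d t : ℝ} (hd : 0 < d) (ht : 0 ≤ t) :
    0 ≤ √t * gfun d t ∧ √t * gfun d t ≤ 1 ∧ t * (1 - √t * gfun d t) ^ 2 ≤ d ∧
    t * gfun d t = √t * (√t * gfun d t) := by
  have h1 : 0 < t + d := by positivity
  have hs : 0 < √(t + d) := Real.sqrt_pos.2 h1
  have h2 : √t ≤ √(t + d) := Real.sqrt_le_sqrt (by linarith)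
  have e1 : √t * √t = t := Real.mul_self_sqrt ht
  have e2 : √(t+d) * √(t+d) = t + d := Real.mul_self_sqrt h1.le
  have h0 := Real.sqrt_nonneg t
  unfold gfun
  rw [abs_of_nonneg ht]
  have h3 : √t * (√(t + d))⁻¹ ≤ 1 := by
    rw [← div_eq_mul_inv, div_le_one hs]; exact h2
  refine ⟨by positivity, h3, ?_, by rw [← mul_assoc, e1]⟩
  set a := √t * (√(t + d))⁻¹ with ha
  have ha0 : 0 ≤ a := by positivity
  have ha2 : a * a * (t + d) = t := by
    rw [ha]; field_simp
    nlinarith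
  have : (1 - a) ^ 2 ≤ 1 - a * a := by nlinarith
  calc t * (1 - a)^2 ≤ t * (1 - a * a) := by gcongr
    _ = a * a * d := by nlinarith
    _ ≤ 1 * d := by gcongr; nlinarith
    _ = d := one_mul d

theorem norm_sq_le {x : A} {r : ℝ} (h : ‖star x * x‖ ≤ r) : ‖x‖ ≤ √r := by
  rw [CStarRing.norm_star_mul_self] at h
  exact Real.le_sqrt_of_sq_le (by rw [sq]; exact h)

/-- Polar decomposition. -/
theorem polar (W : VecFun A) (x : A) : ∃ u e : A, star u * u = e ∧ e * e = e ∧ x * e = x ∧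
    (∀ y, x * y = 0 → e * y = 0) ∧ (∀ y, star x * y = 0 → star u * y = 0) := by
  set h := star x * x with hh
  have hpos : 0 ≤ h := star_mul_self_nonneg x
  have hsp : ∀ t ∈ spectrum ℝ h, 0 ≤ t := fun t ht => spectrum_nonneg_of_nonneg hpos ht
  have hsa : IsSelfAdjoint h := .star_mul_self x
  let d : ℕ → ℝ := fun n => 1 / ((n : ℝ) + 1)
  have hd : ∀ n, 0 < d n := fun n => Nat.one_div_pos_of_nat
  have hd0 : Tendsto d atTop (𝓝 0) := tendsto_one_div_add_atTop_nhds_zero_nat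
  have hds : Tendsto (fun n => √(d n)) atTop (𝓝 0) := by
    have := (Real.continuous_sqrt.tendsto 0).comp hd0
    rw [Real.sqrt_zero] at this
    exact this
  let G : ℕ → A := fun n => cfc (gfun (d n)) h
  let r : A := cfc Real.sqrt h
  have cg : ∀ n, ContinuousOn (gfun (d n)) (spectrum ℝ h) := fun n => (gfun_cont (hd n)).continuousOn
  have cs : ContinuousOn Real.sqrt (spectrum ℝ h) := Real.continuous_sqrt.continuousOn
  have hGs : ∀ n, star (G n) = G n := fun n => (cfc_predicate (gfun (d n)) h)
  have hrs : star r = r := (cfc_predicate Real.sqrt h)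
  have hrr : r * r = h := by
    rw [← cfc_mul Real.sqrt Real.sqrt h cs cs]
    conv_rhs => rw [← cfc_id' ℝ h]
    exact cfc_congr fun t ht => Real.mul_self_sqrt (hsp t ht)
  have hrG : ∀ n, r * G n = cfc (fun t => √t * gfun (d n) t) h := fun n =>
    (cfc_mul _ _ h cs (cg n)).symm
  have hGr : ∀ n, G n * r = r * G n := fun n => (cfc_commute_cfc _ _ h)
  have hhG : ∀ n, h * G n = r * (r * G n) := fun n => by rw [← mul_assoc, hrr]
  have hnk : ∀ n, ‖r * G n‖ ≤ 1 := fun n => by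
    rw [hrG]
    refine norm_cfc_le zero_le_one fun t ht => ?_
    obtain ⟨h1, h2, -, -⟩ := gfun_a (hd n) (hsp t ht)
    rwa [Real.norm_of_nonneg h1]
  have hrk : Tendsto (fun n => r * (r * G n)) atTop (𝓝 r) := by
    rw [tendsto_iff_norm_sub_tendsto_zero]
    refine squeeze_zero (fun _ => norm_nonneg _) (fun n => ?_) hds
    have : r * (r * G n) - r = cfc (fun t => √t * (√t * gfun (d n) t) - √t) h := by
      rw [cfc_sub (fun t => √t * (√t * gfun (d n) t)) Real.sqrt h (cs.mul (cs.mul (cg n))) cs,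
        cfc_mul Real.sqrt (fun t => √t * gfun (d n) t) h cs (cs.mul (cg n)), ← hrG]
    rw [this]
    refine norm_cfc_le (Real.sqrt_nonneg _) fun t ht => ?_
    obtain ⟨h1, h2, h3, -⟩ := gfun_a (hd n) (hsp t ht)
    rw [Real.norm_eq_abs]
    apply Real.abs_le_sqrt
    have e1 : √t * √t = t := Real.mul_self_sqrt (hsp t ht)
    calc _ = (√t * √t) * (1 - √t * gfun (d n) t)^2 := by ring
      _ ≤ _ := by rw [e1]; exact h3
  let u' : ℕ → A := fun n => x * G n
  have hu' : ∀ n, ‖u' n‖ ≤ 1 := fun n => by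
    have : ‖star (u' n) * u' n‖ ≤ 1 := by
      have : star (u' n) * u' n = (r * G n) * (r * G n) := by
        simp only [u', star_mul, hGs]
        calc G n * star x * (x * G n) = G n * (h * G n) := by rw [hh]; simp only [mul_assoc]
          _ = G n * r * (r * G n) := by rw [hhG, mul_assoc]
          _ = _ := by rw [hGr]
      rw [this]
      calc _ ≤ ‖r * G n‖ * ‖r * G n‖ := norm_mul_le _ _
        _ ≤ 1 * 1 := by gcongr <;> exact hnk n
        _ = 1 := one_mul 1
    simpa using norm_sq_le this
  obtain ⟨u, hu⟩ := WLim.exists W (hyperfilter ℕ) u' 1 hu'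
  have hle : (hyperfilter ℕ : Filter ℕ) ≤ atTop := Nat.hyperfilter_le_atTop
  have hux : star u * x = r := by
    have h1 := hu.star.mulR x
    refine h1.unique (WLim.of_tendsto ?_)
    refine (hrk.mono_left hle).congr fun n => ?_
    simp only [u', star_mul, hGs]
    rw [mul_assoc, ← hh, ← hhG]
    have : Commute (G n) h := by
      have := cfc_commute_cfc (gfun (d n)) (fun t => t) h
      rwa [cfc_id' ℝ h] at this
    exact this.symm
  have huu : WLim W (hyperfilter ℕ : Filter ℕ) (fun n => r * G n) (star u * u) := by
    refine (hu.mulL (star u)).congr (Eventually.of_forall fun n => ?_)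
    simp only [u']
    rw [← mul_assoc, hux]
  set e := star u * u with he
  have hes : star e = e := by simp [he]
  have hre : r * e = r := (huu.mulL r).unique (WLim.of_tendsto (hrk.mono_left hle))
  have hxe : x * e = x := by
    have : x * (1 - e) = 0 := by
      apply star_mul_self_zero
      have : star (x * (1 - e)) * (x * (1 - e)) = star (1-e) * (h * (1-e)) := by
        rw [hh]; simp only [star_mul, mul_assoc]
      rw [this, ← hrr, mul_assoc r r, mul_sub r, mul_one, hre]; simp
    rw [mul_sub, mul_one, sub_eq_zero] at this
    exact this.symm
  have her : e * r = r := by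
    have := congrArg star hre
    rwa [star_mul, hrs, hes] at this
  have hGe : ∀ n, G n * e = e * G n := fun n => by
    refine (huu.mulL (G n)).unique ((huu.mulR (G n)).congr (Eventually.of_forall fun m => ?_))
    have h1 : Commute (G n) r := hGr n
    have h2 : Commute (G n) (G m) := cfc_commute_cfc _ _ h
    exact (h1.mul_right h2).symm
  have hue : u * e = u := by
    refine (hu.mulR e).unique (hu.congr (Eventually.of_forall fun n => ?_))
    simp only [u']
    rw [mul_assoc, hGe, ← mul_assoc, hxe]
  refine ⟨u, e, rfl, ?_, hxe, ?_, ?_⟩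
  · rw [he, mul_assoc, ← he, hue]
  · intro y hy
    have hry : r * y = 0 := by
      rw [← hux, mul_assoc, hy, mul_zero]
    refine (huu.mulR y).eq_of_eventually (Eventually.of_forall fun n => ?_)
    rw [← hGr, mul_assoc, hry, mul_zero]
  · intro y hy
    refine (hu.star.mulR y).eq_of_eventually (Eventually.of_forall fun n => ?_)
    simp only [u', star_mul]
    rw [mul_assoc, hy, mul_zero]

/-- Spectral cut. -/
theorem spectral_cut (W : VecFun A) (a : A) (ha : IsSelfAdjoint a) :
    ∃ p : A, Proj p ∧ 0 ≤ p * a * p ∧ (1 - p) * a * (1 - p) ≤ 0 := by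
  obtain ⟨u, e, h1, h2, h3, h4, h5⟩ := polar W (a⁺)
  have hes : star e = e := by rw [← h1]; simp
  have hap : star (a⁺) = a⁺ := (CFC.posPart_nonneg a).star_eq
  have h3' : e * a⁺ = a⁺ := by
    have := congrArg star h3
    rwa [star_mul, hap, hes] at this
  have hm : e * a⁻ = 0 := h4 _ (CFC.posPart_mul_negPart a)
  have hm' : a⁻ * e = 0 := by
    have := congrArg star hm
    rwa [star_mul, hes, (CFC.negPart_nonneg a).star_eq, star_zero] at this
  have hdec : a = a⁺ - a⁻ := (CFC.posPart_sub_negPart a ha).symm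
  refine ⟨e, ⟨hes, h2⟩, ?_, ?_⟩
  · have : e * a * e = a⁺ := by
      conv_lhs => rw [hdec]
      rw [mul_sub, hm, h3', sub_zero, h3]
    rw [this]; exact CFC.posPart_nonneg a
  · have : (1 - e) * a * (1 - e) = - a⁻ := by
      conv_lhs => rw [hdec]
      simp only [mul_sub, sub_mul, hm, hm', h3, h3', one_mul, mul_one]
      simp
    rw [this]; exact neg_nonpos.2 (CFC.negPart_nonneg a)

end Abstract

section Abstract
set_option linter.unusedSectionVars false
open Filter Topology
variable {A : Type*} [CStarAlgebra A] [PartialOrder A] [StarOrderedRing A]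

theorem eq_mul_of_compress {e f : A} (he : star e = e) (hee : e * e = e) (hf : star f = f)
    (hff : f * f = f) (h : e * f * e = e) : f * e = e := by
  have : (1 - f) * e = 0 := by
    apply star_mul_self_zero
    have h1 := (Proj.compl ⟨hf, hff⟩ : Proj (1 - f))
    calc star ((1 - f) * e) * ((1 - f) * e) = e * ((1 - f) * (1 - f)) * e := by
          rw [star_mul, h1.1, he]; simp only [mul_assoc]
      _ = e * e - e * f * e := by rw [h1.2]; simp only [mul_sub, sub_mul, mul_one]
      _ = 0 := by rw [h, hee, sub_self]
  rw [sub_mul, one_mul, sub_eq_zero] at this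
  exact this.symm

theorem norm_le_one_of_idem {s : A} (h : (star s * s) * (star s * s) = star s * s) : ‖s‖ ≤ 1 := by
  set e := star s * s with he
  have hes : star e = e := by simp [he]
  have h1 : ‖e‖ * ‖e‖ = ‖e‖ := by
    have := CStarRing.norm_star_mul_self (x := e)
    rw [hes, h] at this; exact this.symm
  have h2 : ‖s‖ * ‖s‖ = ‖e‖ := (CStarRing.norm_star_mul_self (x := s)).symm
  have h3 : ‖e‖ ≤ 1 := by
    by_contra hc
    nlinarith [norm_nonneg e]
  nlinarith [norm_nonneg s]

/-- The data of a weak limit of an increasing net of (pairs of) partial isometries. -/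
structure IsGlue (W : VecFun A) {ι : Type*} (U : Ultrafilter ι) (s t : ι → A) (S T : A) :
    Prop where
  limS : WLim W (U : Filter ι) s S
  limT : WLim W (U : Filter ι) t T
  limE : WLim W (U : Filter ι) (fun i => star (s i) * s i) (star S * S)
  eS : ∀ i, S * (star (s i) * s i) = s i
  eT : ∀ i, T * (star (s i) * s i) = t i
  EE : (star S * S) * (star S * S) = star S * S
  TT : star T * T = star S * S
  Ee : ∀ i, (star S * S) * (star (s i) * s i) = star (s i) * s i

theorem glue_one (W : VecFun A) {ι : Type*} (U : Ultrafilter ι) (s e : ι → A)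
    (hse : ∀ i, star (s i) * s i = e i) (hid : ∀ i, e i * e i = e i)
    (hev : ∀ i, ∀ᶠ j in (U : Filter ι), s j * e i = s i) :
    ∃ S, WLim W (U : Filter ι) s S ∧ WLim W (U : Filter ι) e (star S * S) ∧
      (∀ i, S * e i = s i) ∧ ∀ i, star S * s i = e i := by
  obtain ⟨S, hS⟩ := WLim.exists W U s 1
    (fun i => norm_le_one_of_idem (by rw [hse, hid]))
  have hes : ∀ i, star (e i) = e i := fun i => by rw [← hse]; simp
  have h1 : ∀ i, S * e i = s i := fun i => (hS.mulR (e i)).eq_of_eventually (hev i)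
  have h2 : ∀ i, star S * s i = e i := fun i => by
    refine (hS.star.mulR (s i)).eq_of_eventually ((hev i).mono fun j hj => ?_)
    rw [← hj, ← mul_assoc, hse]
    refine eq_mul_of_compress (hes i) (hid i) (hes j) (hid j) ?_
    rw [← hse j]
    calc e i * (star (s j) * s j) * e i = star (s j * e i) * (s j * e i) := by
          rw [star_mul, hes]; simp only [mul_assoc]
      _ = e i := by rw [hj, hse]
  refine ⟨S, hS, ?_, h1, h2⟩
  exact (hS.mulL (star S)).congr (Eventually.of_forall fun i => h2 i)

theorem glue (W : VecFun A) {ι : Type*} (U : Ultrafilter ι) (s t : ι → A)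
    (htt : ∀ i, star (t i) * t i = star (s i) * s i)
    (hid : ∀ i, (star (s i) * s i) * (star (s i) * s i) = star (s i) * s i)
    (hev : ∀ i, ∀ᶠ j in (U : Filter ι),
      s j * (star (s i) * s i) = s i ∧ t j * (star (s i) * s i) = t i) :
    ∃ S T, IsGlue W U s t S T := by
  obtain ⟨S, hS, hE, hSe, hSs⟩ := glue_one W U s (fun i => star (s i) * s i) (fun _ => rfl) hid
    (fun i => (hev i).mono fun j hj => hj.1)
  obtain ⟨T, hT, hE', hTe, hTt⟩ := glue_one W U t (fun i => star (s i) * s i) htt hid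
    (fun i => (hev i).mono fun j hj => hj.2)
  have hEe : ∀ i, (star S * S) * (star (s i) * s i) = star (s i) * s i := fun i => by
    rw [mul_assoc, hSe, hSs]
  refine ⟨S, T, hS, hT, hE, hSe, hTe, ?_, hE'.unique hE, hEe⟩
  exact (hE.mulL _).unique (hE.congr (Eventually.of_forall fun i => (hEe i).symm))

/-- Extension order on pairs. -/
def PLE (p q : A × A) : Prop :=
  q.1 * (star p.1 * p.1) = p.1 ∧ q.2 * (star p.1 * p.1) = p.2

theorem PLE.proj {p q : A × A} (h : PLE p q)
    (hp : (star p.1 * p.1) * (star p.1 * p.1) = star p.1 * p.1)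
    (hq : (star q.1 * q.1) * (star q.1 * q.1) = star q.1 * q.1) :
    (star q.1 * q.1) * (star p.1 * p.1) = star p.1 * p.1 := by
  refine eq_mul_of_compress (by simp) hp (by simp) hq ?_
  have : star p.1 * p.1 * (star q.1 * q.1) * (star p.1 * p.1) =
    star (q.1 * (star p.1 * p.1)) * (q.1 * (star p.1 * p.1)) := by simp [mul_assoc]
  rw [this, h.1]

theorem PLE.trans {p q r : A × A} (h : PLE p q) (h' : PLE q r)
    (hp : (star p.1 * p.1) * (star p.1 * p.1) = star p.1 * p.1)
    (hq : (star q.1 * q.1) * (star q.1 * q.1) = star q.1 * q.1) : PLE p r := by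
  have := h.proj hp hq
  refine ⟨?_, ?_⟩
  · rw [← this, ← mul_assoc, h'.1, h.1]
  · rw [← this, ← mul_assoc, h'.2, h.2]

theorem zorn_pair.{v} {A : Type v} [CStarAlgebra A] [PartialOrder A] [StarOrderedRing A]
    (W : VecFun A) (G : Set (A × A))
    (hG : ∀ p ∈ G, star p.2 * p.2 = star p.1 * p.1 ∧
      (star p.1 * p.1) * (star p.1 * p.1) = star p.1 * p.1)
    (hcl : ∀ (ι : Type v) (U : Ultrafilter ι) (s t : ι → A) (S T : A),
      (∀ i, (s i, t i) ∈ G) → (∀ i, ∀ᶠ j in (U : Filter ι),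
        s j * (star (s i) * s i) = s i ∧ t j * (star (s i) * s i) = t i) →
      IsGlue W U s t S T → (S, T) ∈ G) (p₀ : A × A) (hp₀ : p₀ ∈ G) :
    ∃ m ∈ G, (star m.1 * m.1) * (star p₀.1 * p₀.1) = star p₀.1 * p₀.1 ∧
      ∀ q ∈ G, PLE m q → star q.1 * q.1 = star m.1 * m.1 := by
  let X := {p : A × A // p ∈ G ∧ PLE p₀ p}
  let R : X → X → Prop := fun p q => PLE p.1 q.1
  have hrefl : ∀ p ∈ G, PLE p p := fun p hp =>
    ⟨mul_of_star_mul rfl (hG p hp).2, mul_of_star_mul (hG p hp).1 (hG p hp).2⟩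
  have htr : ∀ {a b c : X}, R a b → R b c → R a c := fun {a b c} h h' =>
    PLE.trans h h' (hG _ a.2.1).2 (hG _ b.2.1).2
  obtain ⟨m, hm⟩ := exists_maximal_of_chains_bounded (r := R) (fun c hc => by
    rcases c.eq_empty_or_nonempty with h0 | h0
    · exact ⟨⟨p₀, hp₀, hrefl _ hp₀⟩, by simp [h0]⟩
    have : Nonempty c := h0.to_subtype
    let Fl : Filter c := ⨅ i : c, 𝓟 {j : c | R i.1 j.1}
    have hne : NeBot Fl := by
      refine iInf_neBot_of_directed ?_ ?_
      · intro i j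
        rcases eq_or_ne i j with rfl | hij
        · exact ⟨i, le_rfl, le_rfl⟩
        rcases hc i.2 j.2 (fun h => hij (Subtype.ext h)) with h | h
        · refine ⟨j, ?_, le_rfl⟩
          exact principal_mono.2 fun k (hk : R j.1 k.1) => htr h hk
        · refine ⟨i, le_rfl, ?_⟩
          exact principal_mono.2 fun k (hk : R i.1 k.1) => htr h hk
      · intro i
        exact principal_neBot_iff.2 ⟨i, hrefl _ i.1.2.1⟩
    let U : Ultrafilter c := Ultrafilter.of Fl
    have hev : ∀ i : c, ∀ᶠ j in (U : Filter c), R i.1 j.1 := fun i =>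
      (Ultrafilter.of_le Fl) (mem_iInf_of_mem i (mem_principal_self _))
    obtain ⟨S, T, hST⟩ := glue W U (fun i => i.1.1.1) (fun i => i.1.1.2)
      (fun i => (hG _ i.1.2.1).1) (fun i => (hG _ i.1.2.1).2) hev
    have hmem : (S, T) ∈ G := hcl c U _ _ S T (fun i => i.1.2.1) hev hST
    have hub : ∀ i : c, PLE i.1.1 (S, T) := fun i => ⟨hST.eS i, hST.eT i⟩
    obtain ⟨i₀⟩ := this
    exact ⟨⟨(S, T), hmem, PLE.trans i₀.1.2.2 (hub i₀) (hG _ hp₀).2 (hG _ i₀.1.2.1).2⟩,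
      fun a ha => hub ⟨a, ha⟩⟩) htr
  refine ⟨m.1, m.2.1, PLE.proj m.2.2 (hG _ hp₀).2 (hG _ m.2.1).2, fun q hq hmq => ?_⟩
  have h1 : PLE q m.1 := hm ⟨q, hq, PLE.trans m.2.2 hmq (hG _ hp₀).2 (hG _ m.2.1).2⟩ hmq
  have a1 := PLE.proj h1 (hG _ hq).2 (hG _ m.2.1).2
  have a2 := PLE.proj hmq (hG _ m.2.1).2 (hG _ hq).2
  have a3 := congrArg star a1
  simp only [star_mul, star_star] at a3
  rw [← a3, a2]

end Abstract

section Abstract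
set_option linter.unusedSectionVars false
open Filter Topology
universe v
variable {A : Type v} [CStarAlgebra A] [PartialOrder A] [StarOrderedRing A]

theorem annihilator_unit (W : VecFun A) (x : A) : ∃ c : A, Proj c ∧ Cent c ∧ c * x = 0 ∧
    ∀ y, (∀ a, y * a * x = 0) → y * c = y := by
  let G : Set (A × A) := {p | p.2 = p.1 ∧ star p.1 = p.1 ∧ p.1 * p.1 = p.1 ∧ ∀ a, p.1 * a * x = 0}
  obtain ⟨m, hm, -, hmax⟩ := zorn_pair W G (by
      rintro ⟨e, f⟩ ⟨h1, h2, h3, -⟩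
      simp only at h1 h2 h3
      subst h1
      simp [h2, h3])
    (by
      intro ι U s t S T hG hev hgl
      have h1 : T = S := hgl.limT.unique (hgl.limS.congr (Eventually.of_forall fun i => (hG i).1.symm))
      have h2 : star S = S := hgl.limS.star.unique
        (hgl.limS.congr (Eventually.of_forall fun i => (hG i).2.1.symm))
      refine ⟨h1, h2, ?_, fun a => ?_⟩
      · have : star S * S = S := hgl.limE.unique (hgl.limS.congr (Eventually.of_forall fun i => by
          have h3 := (hG i).2.1
          have h4 := (hG i).2.2.1
          simp only at h3 h4
          simp only [h3, h4]))
        rwa [h2] at this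
      · exact ((hgl.limS.mulR a).mulR x).eq_of_eventually
          (Eventually.of_forall fun i => (hG i).2.2.2 a)) (0, 0) (by simp [G])
  obtain ⟨e, e'⟩ := m
  obtain ⟨h1, h2, h3, h4⟩ := hm
  simp only at h1 h2 h3 h4
  subst h1
  have key : ∀ y, (∀ a, y * a * x = 0) → y * e' = y := by
    intro y hy
    obtain ⟨u, f, huf, hff, hxf, hf, -⟩ := polar W (y * (1 - e'))
    have hfs : star f = f := by rw [← huf]; simp
    have hfe : f * e' = 0 := hf _ (by rw [mul_assoc, sub_mul, one_mul, h3, sub_self, mul_zero])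
    have hef : e' * f = 0 := by simpa [hfs, h2] using congrArg star hfe
    have hfa : ∀ a, f * a * x = 0 := fun a => by
      rw [mul_assoc]
      refine hf _ ?_
      have := h4 a
      rw [mul_assoc] at this
      rw [mul_assoc, sub_mul, one_mul, this, sub_zero, ← mul_assoc, hy]
    have hsum : (e' + f) * (e' + f) = e' + f := by
      rw [mul_add, add_mul, add_mul, h3, hff, hfe, hef]; simp
    have := hmax (e' + f, e' + f) ⟨rfl, by simp [h2, hfs], hsum, fun a => by
      simp only
      rw [add_mul, add_mul, h4, hfa, add_zero]⟩ ⟨by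
        simp only [h2, h3]; rw [add_mul, h3, hfe, add_zero], by
        simp only [h2, h3]; rw [add_mul, h3, hfe, add_zero]⟩
    simp only [star_add, h2, hfs, hsum, h3] at this
    have hf0 : f = 0 := by simpa using this
    rw [hf0, mul_zero] at hxf
    rw [mul_sub, mul_one] at hxf
    exact (sub_eq_zero.1 hxf.symm).symm
  have hc : Cent e' := by
    have h5 : ∀ b, e' * b * e' = e' * b := fun b => key _ fun a => by
      rw [mul_assoc e' b a]; exact h4 _
    intro b
    have h6 := congrArg star (h5 (star b))
    simp only [star_mul, star_star, h2] at h6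
    rw [← h5 b, mul_assoc, h6]
  exact ⟨e', ⟨h2, h3⟩, hc, by simpa using h4 1, key⟩

/-- Comparison theorem for projections. -/
theorem compare (W : VecFun A) (p q : A) (hp : Proj p) (hq : Proj q) :
    ∃ c, Proj c ∧ Cent c ∧ (∃ v, star v * v = c * p ∧ q * v = v) ∧
      ∃ w, star w * w = (1 - c) * q ∧ p * w = w := by
  let G : Set (A × A) := {r | r.2 = r.1 ∧ (star r.1 * r.1) * (star r.1 * r.1) = star r.1 * r.1 ∧
    q * r.1 = r.1 ∧ r.1 * p = r.1}
  obtain ⟨m, hm, -, hmax⟩ := zorn_pair W G (by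
      rintro ⟨e, f⟩ ⟨h1, h2, -, -⟩
      simp only at h1 h2
      subst h1
      exact ⟨rfl, h2⟩)
    (by
      intro ι U s t S T hG hev hgl
      have h1 : T = S := hgl.limT.unique (hgl.limS.congr (Eventually.of_forall fun i => (hG i).1.symm))
      refine ⟨h1, hgl.EE, ?_, ?_⟩
      · exact (hgl.limS.mulL q).unique (hgl.limS.congr (Eventually.of_forall fun i => (hG i).2.2.1.symm))
      · exact (hgl.limS.mulR p).unique (hgl.limS.congr (Eventually.of_forall fun i => (hG i).2.2.2.symm)))
    (0, 0) (by simp [G])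
  obtain ⟨v, v'⟩ := m
  obtain ⟨h1, h2, h3, h4⟩ := hm
  simp only at h1 h2 h3 h4
  subst h1
  set e := star v' * v' with he
  have hes : star e = e := by simp [he]
  have hve : v' * e = v' := mul_of_star_mul rfl h2
  have hev : e * star v' = star v' := by simpa [hes] using congrArg star hve
  have hvq : star v' * q = star v' := by simpa [hq.1] using congrArg star h3
  have hpv : p * star v' = star v' := by simpa [hp.1] using congrArg star h4
  have hep : e * p = e := by rw [he, mul_assoc, h4]
  have hpe : p * e = e := by simpa [hp.1, hes] using congrArg star hep
  have k1 : (p - e) * e = 0 := by rw [sub_mul, hpe, h2, sub_self]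
  have k2 : (p - e) * (1 - p) = 0 := by rw [mul_sub, mul_one, sub_mul, hp.2, hep, sub_self]
  have k3 : (q - v' * star v') * (1 - q) = 0 := by
    rw [mul_sub, mul_one, sub_mul, hq.2, mul_assoc, hvq, sub_self]
  have key : ∀ y, (q - v' * star v') * y * (p - e) = 0 := by
    intro y
    obtain ⟨u, f, huf, hff, hxf, hf, hu⟩ := polar W ((q - v' * star v') * y * (p - e))
    have hfs : star f = f := by rw [← huf]; simp
    have hfe : f * e = 0 := hf _ (by rw [mul_assoc, k1, mul_zero])
    have hef : e * f = 0 := by simpa [hfs, hes] using congrArg star hfe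
    have hfp : f * p = f := by
      have := hf (1 - p) (by
        rw [mul_assoc, k2, mul_zero])
      rw [mul_sub, mul_one] at this
      exact (sub_eq_zero.1 this).symm
    have huf' : u * f = u := mul_of_star_mul huf hff
    have hup : u * p = u := by rw [← huf', mul_assoc, hfp]
    have hqs : star (q - v' * star v') = q - v' * star v' := by simp [hq.1]
    have huq : q * u = u := by
      have := hu (1 - q) (by
        rw [star_mul, star_mul, hqs, mul_assoc, mul_assoc, k3, mul_zero, mul_zero])
      rw [mul_sub, mul_one] at this
      have := congrArg star (sub_eq_zero.1 this)
      simpa [hq.1] using this.symm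
    have huv : star u * v' = 0 := hu _ (by
      rw [star_mul, star_mul, hqs, mul_assoc, mul_assoc, sub_mul, h3, mul_assoc v', ← he, hve,
        sub_self, mul_zero, mul_zero])
    have hvu : star v' * u = 0 := by simpa using congrArg star huv
    have hss : star (v' + u) * (v' + u) = e + f := by
      rw [star_add, mul_add, add_mul, add_mul, huv, hvu, huf, ← he]; simp
    have hue : u * e = 0 := by rw [← huf', mul_assoc, hfe, mul_zero]
    have := hmax (v' + u, v' + u) ⟨rfl, by
        simp only [hss]
        rw [mul_add, add_mul, add_mul, h2, hff, hfe, hef]; simp, by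
        simp only [mul_add, h3, huq], by
        simp only [add_mul, h4, hup]⟩ ⟨by
        simp only [← he]; rw [add_mul, hve, hue, add_zero], by
        simp only [← he]; rw [add_mul, hve, hue, add_zero]⟩
    simp only [hss, ← he] at this
    have hf0 : f = 0 := by simpa using this
    rw [hf0, mul_zero] at hxf
    exact hxf.symm
  obtain ⟨c, hcp, hcc, hcx, hcy⟩ := annihilator_unit W (p - e)
  have hqc := hcy _ key
  refine ⟨c, hcp, hcc, ⟨v' * c, ?_, ?_⟩, ⟨star v' * (1 - c), ?_, ?_⟩⟩
  · rw [star_mul, hcp.1, mul_assoc, ← mul_assoc (star v'), ← he, ← hcc e, ← mul_assoc, hcp.2]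
    rw [mul_sub, sub_eq_zero] at hcx
    exact hcx.symm
  · rw [← mul_assoc, h3]
  · have h5 : (q - v' * star v') * (1 - c) = 0 := by rw [mul_sub, mul_one, hqc, sub_self]
    rw [sub_mul, sub_eq_zero] at h5
    have h6 : (1 - c) * q = q * (1 - c) := by rw [sub_mul, mul_sub, hcc]; simp
    rw [star_mul, star_star, hcp.compl.1, h6, h5]
    have h7 : (1 - c) * v' = v' * (1 - c) := by rw [sub_mul, mul_sub, hcc]; simp
    have h8 : (1 - c) * star v' = star v' * (1 - c) := by rw [sub_mul, mul_sub, hcc]; simp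
    rw [h7, mul_assoc, ← mul_assoc (1 - c) (star v'), h8, mul_assoc (star v'), hcp.compl.2, mul_assoc]
  · rw [← mul_assoc, hpv]

end Abstract

section Abstract
set_option linter.unusedSectionVars false
open Filter Topology
universe v
variable {A : Type v} [CStarAlgebra A] [PartialOrder A] [StarOrderedRing A]

theorem ra {a b c : A} (h : a * b = c) (x : A) : a * (b * x) = c * x := by rw [← mul_assoc, h]

theorem mu_sum (g : A) (a : ℕ → A) (hag : ∀ i, a i * g = a i)
    (ha : ∀ i j, star (a i) * a j = if i = j then g else 0) (α β γ δ : ℕ → ℕ) (N M : ℕ) :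
    (∑ i ∈ Finset.range N, a (α i) * star (a (γ i))) *
      (∑ j ∈ Finset.range M, a (β j) * star (a (δ j))) =
    ∑ i ∈ Finset.range N, ∑ j ∈ Finset.range M,
      if γ i = β j then a (α i) * star (a (δ j)) else 0 := by
  rw [Finset.sum_mul_sum]
  refine Finset.sum_congr rfl fun i _ => Finset.sum_congr rfl fun j _ => ?_
  rw [mul_assoc, ← mul_assoc (star (a (γ i))), ha]
  split_ifs with h
  · rw [← mul_assoc, hag]
  · simp

theorem mu_sum_le (g : A) (a : ℕ → A) (hag : ∀ i, a i * g = a i)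
    (ha : ∀ i j, star (a i) * a j = if i = j then g else 0) (α β γ δ : ℕ → ℕ) (N M : ℕ)
    (hβ : Function.Injective β) (k : ℕ → ℕ) (hk : ∀ i < N, k i < M ∧ γ i = β (k i)) :
    (∑ i ∈ Finset.range N, a (α i) * star (a (γ i))) *
      (∑ j ∈ Finset.range M, a (β j) * star (a (δ j))) =
    ∑ i ∈ Finset.range N, a (α i) * star (a (δ (k i))) := by
  rw [mu_sum g a hag ha]
  refine Finset.sum_congr rfl fun i hi => ?_
  have := hk i (Finset.mem_range.1 hi)
  rw [Finset.sum_eq_single (k i)]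
  · simp [this.2]
  · intro j _ hj
    rw [if_neg]
    rw [this.2]
    exact fun h => hj (hβ h).symm
  · intro h; exact absurd (Finset.mem_range.2 this.1) h

theorem mu_sum_ge (g : A) (a : ℕ → A) (hag : ∀ i, a i * g = a i)
    (ha : ∀ i j, star (a i) * a j = if i = j then g else 0) (α β γ δ : ℕ → ℕ) (N M : ℕ)
    (hγ : Function.Injective γ) (k : ℕ → ℕ) (hk : ∀ j < M, k j < N ∧ γ (k j) = β j) :
    (∑ i ∈ Finset.range N, a (α i) * star (a (γ i))) *
      (∑ j ∈ Finset.range M, a (β j) * star (a (δ j))) =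
    ∑ j ∈ Finset.range M, a (α (k j)) * star (a (δ j)) := by
  rw [mu_sum g a hag ha, Finset.sum_comm]
  refine Finset.sum_congr rfl fun i hi => ?_
  have := hk i (Finset.mem_range.1 hi)
  rw [Finset.sum_eq_single (k i)]
  · simp [this.2]
  · intro j _ hj
    rw [if_neg]
    rw [← this.2]
    exact fun h => hj (hγ h)
  · intro h; exact absurd (Finset.mem_range.2 this.1) h

theorem shift_pair (W : VecFun A) (z v : A) (hz : Proj z) (hc : Cent z) (hv : star v * v = z)
    (hzv : z * (v * star v) = v * star v) (hne : v * star v ≠ z) :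
    ∃ S T : A, star T * T = star S * S ∧ (star S * S) * (star S * S) = star S * S ∧
      (star S * S) * S = S ∧ (star S * S) * T = T ∧ star S * T = 0 ∧ z * (star S * S) = star S * S
      ∧ star S * S ≠ 0 := by
  set g := z - v * star v with hg
  have hvz : v * z = v := mul_of_star_mul hv hz.2
  have hzv' : z * v = v := by rw [hc, hvz]
  have hzs : z * star v = star v := by simpa [hz.1] using congrArg star hvz
  have hsz : star v * z = star v := by rw [← hc, hzs]
  have hgs : star g = g := by simp [hg, hz.1]
  have hsg : star v * g = 0 := by rw [hg, mul_sub, ← mul_assoc, hv, hzs, hsz, sub_self]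
  have hgv : g * v = 0 := by simpa [hgs] using congrArg star hsg
  have hzg : z * g = g := by rw [hg, mul_sub, hz.2, hzv]
  have hgg : g * g = g := by
    nth_rw 1 [hg]
    rw [sub_mul, hzg, mul_assoc, hsg, mul_zero, sub_zero]
  have hg0 : g ≠ 0 := fun h => hne (sub_eq_zero.1 h).symm
  let a : ℕ → A := fun n => v ^ n * g
  have a0 : a 0 = g := by simp [a]
  have as : ∀ n, a (n + 1) = v * a n := fun n => by simp [a, pow_succ', mul_assoc]
  have hza : ∀ n, z * a n = a n := fun n => by
    simp only [a]; rw [← mul_assoc, hc, mul_assoc, hzg]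
  have hag : ∀ i, a i * g = a i := fun i => by simp only [a]; rw [mul_assoc, hgg]
  have ha : ∀ i j, star (a i) * a j = if i = j then g else 0 := by
    intro i
    induction i with
    | zero =>
      intro j
      cases j with
      | zero => simp [a0, hgs, hgg]
      | succ j => rw [as, a0, hgs, ← mul_assoc, hgv]; simp
    | succ i ih =>
      intro j
      cases j with
      | zero =>
        rw [as, a0, star_mul, mul_assoc, hsg]; simp
      | succ j =>
        rw [as, as, star_mul, mul_assoc, ← mul_assoc (star v), hv, hza, ih]
        simp
  let s : (ℕ → ℕ) → ℕ → A := fun α N => ∑ i ∈ Finset.range N, a (α i) * star (a i)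
  have hss : ∀ α N, star (s α N) = ∑ i ∈ Finset.range N, a i * star (a (α i)) := fun α N => by
    simp [s]
  let α : ℕ → ℕ := fun i => 2 * i
  let β : ℕ → ℕ := fun i => 2 * i + 1
  have hα : Function.Injective α := fun i j h => by simp only [α] at h; omega
  have hβ : Function.Injective β := fun i j h => by simp only [β] at h; omega
  have hE : ∀ γ, Function.Injective γ → ∀ N, star (s γ N) * s γ N = s id N := by
    intro γ hγ N
    rw [hss]
    exact mu_sum_ge g a hag ha id γ γ id N N hγ id (fun j hj => ⟨hj, rfl⟩)
  have hst : ∀ N M, star (s α N) * s β M = 0 := by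
    intro N M
    rw [hss]
    refine (mu_sum g a hag ha id β α id N M).trans ?_
    refine Finset.sum_eq_zero fun i _ => Finset.sum_eq_zero fun j _ => if_neg ?_
    simp only [α, β]; omega
  have hse : ∀ γ N M, N ≤ M → s γ M * s id N = s γ N := by
    intro γ N M h
    exact mu_sum_ge g a hag ha γ id id id M N Function.injective_id id
      (fun j hj => ⟨lt_of_lt_of_le hj h, rfl⟩)
  have hes : ∀ γ N, ∃ K, ∀ M, K ≤ M → s id M * s γ N = s γ N := by
    intro γ N
    refine ⟨∑ i ∈ Finset.range N, (γ i + 1), fun M h => ?_⟩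
    refine mu_sum_ge g a hag ha id γ id id M N Function.injective_id γ
      (fun j hj => ⟨lt_of_lt_of_le ?_ h, rfl⟩)
    exact Nat.lt_of_succ_le (Finset.single_le_sum (f := fun i => γ i + 1) (fun _ _ => Nat.zero_le _)
      (Finset.mem_range.2 hj))
  have hU : (↑(hyperfilter ℕ) : Filter ℕ) ≤ atTop := by
    rw [← Nat.cofinite_eq_atTop]; exact hyperfilter_le_cofinite
  have ev : ∀ (K : ℕ) (P : ℕ → Prop), (∀ M, K ≤ M → P M) → ∀ᶠ M in (↑(hyperfilter ℕ) : Filter ℕ), P M :=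
    fun K P h => hU ((eventually_ge_atTop K).mono h)
  obtain ⟨S, T, hgl⟩ := glue W (hyperfilter ℕ) (s α) (s β) (fun i => by rw [hE _ hα, hE _ hβ])
    (fun i => by rw [hE _ hα, hse _ _ _ le_rfl])
    (fun i => ev i _ fun M hM => by
      rw [hE _ hα]; exact ⟨hse _ _ _ hM, hse _ _ _ hM⟩)
  have hlE : WLim W (↑(hyperfilter ℕ) : Filter ℕ) (s id) (star S * S) :=
    hgl.limE.congr (Eventually.of_forall fun i => hE _ hα i)
  have hEs : ∀ γ N, (star S * S) * s γ N = s γ N := fun γ N => by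
    obtain ⟨K, hK⟩ := hes γ N
    exact (hlE.mulR _).eq_of_eventually (ev K _ hK)
  refine ⟨S, T, hgl.TT, hgl.EE, ?_, ?_, ?_, ?_, ?_⟩
  · exact (hgl.limS.mulL _).unique (hgl.limS.congr (Eventually.of_forall fun i => (hEs _ _).symm))
  · exact (hgl.limT.mulL _).unique (hgl.limT.congr (Eventually.of_forall fun i => (hEs _ _).symm))
  · refine (hgl.limT.mulL _).eq_of_eventually (Eventually.of_forall fun i => ?_)
    exact (hgl.limS.star.mulR _).eq_of_eventually (Eventually.of_forall fun j => hst _ _)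
  · refine (hlE.mulL z).unique (hlE.congr (Eventually.of_forall fun i => ?_))
    simp only [s, Finset.mul_sum]
    refine Finset.sum_congr rfl fun i _ => ?_
    rw [← mul_assoc, hza]
  · intro h0
    have := hEs id 1
    rw [h0] at this
    simp [s, a0, hgs, hgg] at this
    exact hg0 this.symm

end Abstract

section Abstract
set_option linter.unusedSectionVars false
open Filter Topology
universe v
variable {A : Type v} [CStarAlgebra A] [PartialOrder A] [StarOrderedRing A]

/-- abstract proper infiniteness -/
def PI (A : Type v) [CStarAlgebra A] : Prop :=
  ∀ p : A, (star p = p ∧ p * p = p) → (∀ a, p * a = a * p) →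
    (∀ v : A, star v * v = p → p * (v * star v) = v * star v → v * star v = p) → p = 0

theorem half_central (W : VecFun A) (hPI : PI A) (z : A) (hz : Proj z) (hc : Cent z) (hz0 : z ≠ 0) :
    ∃ S T c : A, Proj c ∧ Cent c ∧ c ≠ 0 ∧ z * c = c ∧ star S * S = c ∧ star T * T = c ∧
      star S * T = 0 := by
  obtain ⟨v₀, hv, hzv, hne⟩ : ∃ v, star v * v = z ∧ z * (v * star v) = v * star v ∧ v * star v ≠ z := by
    by_contra! h
    exact hz0 (hPI z hz hc h)
  obtain ⟨S₀, T₀, a1, a2, a3, a4, a5, a6, a7⟩ := shift_pair W z v₀ hz hc hv hzv hne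
  let G : Set (A × A) := {r | star r.2 * r.2 = star r.1 * r.1 ∧
    (star r.1 * r.1) * (star r.1 * r.1) = star r.1 * r.1 ∧
      (star r.1 * r.1) * r.1 = r.1 ∧ (star r.1 * r.1) * r.2 = r.2 ∧ star r.1 * r.2 = 0 ∧
      z * (star r.1 * r.1) = star r.1 * r.1}
  obtain ⟨m, hm, hm0, hmax⟩ := zorn_pair W G (fun p h => ⟨h.1, h.2.1⟩)
    (by
      intro ι U s t S T hG hev hgl
      have hEs : ∀ j, (star S * S) * s j = s j := fun j => by
        have := (hG j).2.2.1
        simp only at this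
        rw [← this, ← mul_assoc, hgl.Ee]
      have hEt : ∀ j, (star S * S) * t j = t j := fun j => by
        have := (hG j).2.2.2.1
        simp only at this
        rw [← this, ← mul_assoc, hgl.Ee]
      have hij : ∀ i j, star (s i) * t j = 0 := by
        intro i j
        obtain ⟨k, h1, h2⟩ := ((hev i).and (hev j)).exists
        have := (hG k).2.2.2.2.1
        simp only at this
        rw [← h1.1, ← h2.2, star_mul, mul_assoc, ← mul_assoc (star (s k)), this]
        simp
      refine ⟨hgl.TT, hgl.EE, ?_, ?_, ?_, ?_⟩
      · exact (hgl.limS.mulL _).unique (hgl.limS.congr (Eventually.of_forall fun i => (hEs _).symm))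
      · exact (hgl.limT.mulL _).unique (hgl.limT.congr (Eventually.of_forall fun i => (hEt _).symm))
      · refine (hgl.limT.mulL _).eq_of_eventually (Eventually.of_forall fun i => ?_)
        exact (hgl.limS.star.mulR _).eq_of_eventually (Eventually.of_forall fun j => hij _ _)
      · exact (hgl.limE.mulL z).unique
          (hgl.limE.congr (Eventually.of_forall fun i => (hG i).2.2.2.2.2.symm)))
    (S₀, T₀) ⟨a1, a2, a3, a4, a5, a6⟩
  obtain ⟨s, t⟩ := m
  obtain ⟨b1, b2, b3, b4, b5, b6⟩ := hm
  simp only at b1 b2 b3 b4 b5 b6 hm0 hmax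
  obtain ⟨e, he⟩ : ∃ e, star s * s = e := ⟨_, rfl⟩
  rw [he] at b1 b2 b3 b4 b6 hm0 hmax
  have he0 : e ≠ 0 := by
    rintro rfl
    rw [zero_mul] at hm0
    exact a7 hm0.symm
  have hes : star e = e := by rw [← he]; simp
  have b3' : star s * e = star s := by simpa [hes] using congrArg star b3
  have b4' : star t * e = star t := by simpa [hes] using congrArg star b4
  have b5' : star t * s = 0 := by simpa using congrArg star b5
  have b6' : e * z = e := by rw [← hc, b6]
  have hfP : Proj (z - e) := ⟨by simp [hz.1, hes], by
    rw [sub_mul, mul_sub, mul_sub, hz.2, b6, b6', b2]; simp⟩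
  obtain ⟨c, hcP, hcC, ⟨v, hv1, hv2⟩, ⟨w, hw1, hw2⟩⟩ := compare W (z - e) e hfP ⟨hes, b2⟩
  have hv2' : star v * e = star v := by simpa [hes] using congrArg star hv2
  by_cases hce : c * e = 0
  · exfalso
    rw [sub_mul, one_mul, hce, sub_zero] at hw1
    have ew : e * w = 0 := by rw [← hw2, ← mul_assoc, mul_sub, b6', b2, sub_self, zero_mul]
    have we : star w * e = 0 := by simpa [hes] using congrArg star ew
    have zw : z * w = w := by
      rw [← hw2, ← mul_assoc, mul_sub, hz.2, b6]
    have w_e : w * e = w := mul_of_star_mul hw1 b2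
    have e_w : e * star w = star w := by simpa [hes] using congrArg star w_e
    have sw : star s * w = 0 := by rw [← b3', mul_assoc, ew, mul_zero]
    have ws : star w * s = 0 := by simpa using congrArg star sw
    have tw : star t * w = 0 := by rw [← b4', mul_assoc, ew, mul_zero]
    have wt : star w * t = 0 := by simpa using congrArg star tw
    have h1 : star (s + w * s * star w) * (s + w * s * star w) = e + w * star w := by
      simp only [star_add, star_mul, star_star, mul_add, add_mul, mul_assoc, he, ra he, sw, ra sw, ws,
        ra ws, hw1, ra hw1, b3, ra b3, e_w, zero_mul, mul_zero, add_zero, zero_add]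
    have h2 : star (t + w * t * star w) * (t + w * t * star w) = e + w * star w := by
      simp only [star_add, star_mul, star_star, mul_add, add_mul, mul_assoc, b1, ra b1, tw, ra tw, wt,
        ra wt, hw1, ra hw1, b4, ra b4, e_w, zero_mul, mul_zero, add_zero, zero_add]
    have h3 : (e + w * star w) * (e + w * star w) = e + w * star w := by
      simp only [mul_add, add_mul, mul_assoc, b2, ew, ra ew, we, hw1, ra hw1, e_w, zero_mul, mul_zero,
        add_zero, zero_add]
    have := hmax (s + w * s * star w, t + w * t * star w) ⟨by simp only [h1, h2], by simp only [h1, h3],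
        by
          simp only [h1]
          simp only [mul_add, add_mul, mul_assoc, b3, ew, ra ew, ws, hw1, ra hw1, ra b3, e_w, zero_mul,
            mul_zero, add_zero, zero_add],
        by
          simp only [h1]
          simp only [mul_add, add_mul, mul_assoc, b4, ew, ra ew, wt, hw1, ra hw1, ra b4, e_w, zero_mul,
            mul_zero, add_zero, zero_add],
        by
          simp only [star_add, star_mul, star_star, mul_add, add_mul, mul_assoc, b5, ra b5, sw, ra sw, wt,
            ra wt, hw1, ra hw1, b4, ra b4, e_w, zero_mul, mul_zero, add_zero, zero_add],
        by simp only [h1, mul_add, b6, ra zw]⟩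
      ⟨by
        simp only [he]
        rw [add_mul, mul_assoc, mul_assoc, we]
        simp only [mul_zero, add_zero]
        exact mul_of_star_mul he b2, by
        simp only [he]
        rw [add_mul, mul_assoc, mul_assoc, we]
        simp only [mul_zero, add_zero]
        exact mul_of_star_mul b1 b2⟩
    simp only [h1] at this
    have hw0 : w * star w = 0 := by simpa using this
    have : star w = 0 := star_mul_self_zero (by simpa using hw0)
    rw [star_eq_zero] at this
    rw [this] at hw1
    simp at hw1
    exact he0 hw1.symm
  · have hX : star (s * c + t * v) * (s * c + t * v) = c * z := by
      have h1 : e * c = c * e := (hcC e).symm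
      have h2 : star v * (e * v) = c * z - c * e := by rw [hv2, hv1, mul_sub]
      simp only [star_add, star_mul, star_star, hcP.1, mul_add, add_mul, mul_assoc, he, ra he, b1, ra b1,
        b5, ra b5, b5', ra b5', zero_mul, mul_zero, add_zero, zero_add, h2]
      rw [h1, ← mul_assoc, hcP.2]
      abel
    have heX : e * (s * c + t * v) = s * c + t * v := by
      rw [mul_add, ← mul_assoc, ← mul_assoc, b3, b4]
    refine ⟨s * (s * c + t * v), t * (s * c + t * v), c * z, ⟨?_, ?_⟩, ?_, ?_, ?_, ?_, ?_, ?_⟩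
    · rw [star_mul, hz.1, hcP.1, hc]
    · rw [mul_assoc, ← mul_assoc z, hc c, mul_assoc c z, hz.2, ← mul_assoc, hcP.2]
    · intro a; rw [mul_assoc, hc, ← mul_assoc, hcC, mul_assoc]
    · intro h
      apply hce
      have : c * z * e = 0 := by rw [h, zero_mul]
      rwa [mul_assoc, b6] at this
    · rw [hc, mul_assoc, hz.2]
    · rw [star_mul, mul_assoc, ← mul_assoc (star s), he, heX, hX]
    · rw [star_mul, mul_assoc, ← mul_assoc (star t), b1, heX, hX]
    · rw [star_mul, mul_assoc, ← mul_assoc (star s), b5, zero_mul, mul_zero]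

theorem two_isometries (W : VecFun A) (hPI : PI A) :
    ∃ s t : A, star s * s = 1 ∧ star t * t = 1 ∧ star s * t = 0 := by
  let G : Set (A × A) := {r | star r.2 * r.2 = star r.1 * r.1 ∧
    (star r.1 * r.1) * (star r.1 * r.1) = star r.1 * r.1 ∧
      Cent (star r.1 * r.1) ∧ star r.1 * r.2 = 0}
  obtain ⟨m, hm, -, hmax⟩ := zorn_pair W G (fun p h => ⟨h.1, h.2.1⟩)
    (by
      intro ι U s t S T hG hev hgl
      have hij : ∀ i j, star (s i) * t j = 0 := by
        intro i j
        obtain ⟨k, h1, h2⟩ := ((hev i).and (hev j)).exists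
        have := (hG k).2.2.2
        simp only at this
        rw [← h1.1, ← h2.2, star_mul, mul_assoc, ← mul_assoc (star (s k)), this]
        simp
      refine ⟨hgl.TT, hgl.EE, fun a => ?_, ?_⟩
      · exact (hgl.limE.mulR a).unique
          ((hgl.limE.mulL a).congr (Eventually.of_forall fun i => ((hG i).2.2.1 a).symm))
      · refine (hgl.limT.mulL _).eq_of_eventually (Eventually.of_forall fun i => ?_)
        exact (hgl.limS.star.mulR _).eq_of_eventually (Eventually.of_forall fun j => hij _ _))
    (0, 0) (by simp [G, Cent])
  obtain ⟨s, t⟩ := m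
  obtain ⟨b1, b2, b3, b4⟩ := hm
  simp only at b1 b2 b3 b4 hmax
  obtain ⟨c, he⟩ : ∃ e, star s * s = e := ⟨_, rfl⟩
  rw [he] at b1 b2 b3 hmax
  have hcP : Proj c := ⟨by rw [← he]; simp, b2⟩
  by_cases h1 : 1 - c = 0
  · have : c = 1 := (sub_eq_zero.1 h1).symm
    subst this
    exact ⟨s, t, he, b1, b4⟩
  exfalso
  obtain ⟨S, T, d, hd, hdc, hd0, hzd, hS, hT, hST⟩ := half_central W hPI (1 - c) hcP.compl
    (fun a => by rw [sub_mul, mul_sub, b3]; simp) h1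
  have hcd : c * d = 0 := by rw [sub_mul, one_mul] at hzd; simpa using hzd
  have hdc' : d * c = 0 := by rw [← b3, hcd]
  have sc : s * c = s := mul_of_star_mul he b2
  have tc : t * c = t := mul_of_star_mul b1 b2
  have cs : c * star s = star s := by simpa [hcP.1] using congrArg star sc
  have ct : c * star t = star t := by simpa [hcP.1] using congrArg star tc
  have Sd : S * d = S := mul_of_star_mul hS hd.2
  have Td : T * d = T := mul_of_star_mul hT hd.2
  have cS : c * S = 0 := by rw [b3, ← Sd, mul_assoc, hdc', mul_zero]
  have cT : c * T = 0 := by rw [b3, ← Td, mul_assoc, hdc', mul_zero]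
  have x1 : star s * S = 0 := by rw [← cs, b3, mul_assoc, cS, mul_zero]
  have x2 : star s * T = 0 := by rw [← cs, b3, mul_assoc, cT, mul_zero]
  have x3 : star t * S = 0 := by rw [← ct, b3, mul_assoc, cS, mul_zero]
  have x4 : star t * T = 0 := by rw [← ct, b3, mul_assoc, cT, mul_zero]
  have y1 : star S * s = 0 := by simpa using congrArg star x1
  have y3 : star S * t = 0 := by simpa using congrArg star x3
  have y4 : star T * t = 0 := by simpa using congrArg star x4
  have k1 : star (s + S) * (s + S) = c + d := by
    simp only [star_add, mul_add, add_mul, he, x1, y1, hS, add_zero, zero_add]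
  have k2 : star (t + T) * (t + T) = c + d := by
    simp only [star_add, mul_add, add_mul, b1, x4, y4, hT, add_zero, zero_add]
  have := hmax (s + S, t + T) ⟨by simp only [k1, k2], by
      simp only [k1]
      simp only [mul_add, add_mul, b2, hd.2, hcd, hdc', add_zero, zero_add], by
      simp only [k1]
      intro a; rw [add_mul, mul_add, b3, hdc], by
      simp only [star_add, mul_add, add_mul, b4, x2, y3, hST, add_zero]⟩
    ⟨by
      simp only [he]
      rw [add_mul, sc, ← b3, cS, add_zero], by
      simp only [he]
      rw [add_mul, tc, ← b3, cT, add_zero]⟩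
  simp only [k1] at this
  exact hd0 (by simpa using this)

end Abstract

section Abstract
set_option linter.unusedSectionVars false
open Filter Topology
universe v
variable {A : Type v} [CStarAlgebra A] [PartialOrder A] [StarOrderedRing A]

theorem claimA (W : VecFun A) (hPI : PI A) (p : A) (hp : Proj p) :
    ∃ c d d' : A, Proj c ∧ Cent c ∧ star d * d = c ∧ (1 - p) * d = d ∧ star d' * d' = 1 - c ∧
      p * d' = d' := by
  obtain ⟨s, t, hs, ht, hst⟩ := two_isometries W hPI
  have hts : star t * s = 0 := by simpa using congrArg star hst
  obtain ⟨q, hq⟩ : ∃ q, q = 1 - p := ⟨_, rfl⟩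
  have hqP : Proj q := hq ▸ hp.compl
  have hpq : p = 1 - q := by rw [hq]; simp
  rw [← hq]
  obtain ⟨u1, e1, a1, a2, a3, a4, a5⟩ := polar W (q * s)
  obtain ⟨u2, e2, b1, b2, b3, b4, b5⟩ := polar W (p * t)
  have he1 : Proj e1 := ⟨by rw [← a1]; simp, a2⟩
  have he2 : Proj e2 := ⟨by rw [← b1]; simp, b2⟩
  obtain ⟨c, hc, hcc, ⟨v, hv1, hv2⟩, ⟨w, hw1, hw2⟩⟩ := compare W (1 - e1) (1 - e2) he1.compl he2.compl
  have qu : q * u1 = u1 := by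
    have := a5 (1 - q) (by rw [star_mul, hqP.1, mul_assoc, mul_sub, mul_one, hqP.2]; simp)
    rw [mul_sub, mul_one, sub_eq_zero] at this
    simpa [hqP.1] using (congrArg star this).symm
  have pu : p * u2 = u2 := by
    have := b5 (1 - p) (by rw [star_mul, hp.1, mul_assoc, mul_sub, mul_one, hp.2]; simp)
    rw [mul_sub, mul_one, sub_eq_zero] at this
    simpa [hp.1] using (congrArg star this).symm
  have qtv : q * (t * v) = t * v := by
    have : p * t * (1 - e2) = 0 := by rw [mul_sub, mul_one, b3, sub_self]
    have : p * (t * v) = 0 := by rw [← hv2, ← mul_assoc, ← mul_assoc, this, zero_mul]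
    rw [hq, sub_mul, this]; simp
  have psw : p * (s * w) = s * w := by
    have : q * s * (1 - e1) = 0 := by rw [mul_sub, mul_one, a3, sub_self]
    have : q * (s * w) = 0 := by rw [← hw2, ← mul_assoc, ← mul_assoc, this, zero_mul]
    rw [hpq, sub_mul, this]; simp
  have x1 : star u1 * (t * v) = 0 := a5 _ (by
    rw [star_mul, hqP.1, mul_assoc, qtv, ← mul_assoc, hst, zero_mul])
  have x2 : star u2 * (s * w) = 0 := b5 _ (by
    rw [star_mul, hp.1, mul_assoc, psw, ← mul_assoc, hts, zero_mul])
  have y1 : star v * (star t * u1) = 0 := by simpa [mul_assoc] using congrArg star x1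
  have y2 : star w * (star s * u2) = 0 := by simpa [mul_assoc] using congrArg star x2
  obtain ⟨f, hf⟩ : ∃ f, f = 1 - c := ⟨_, rfl⟩
  have hfP : Proj f := hf ▸ hc.compl
  have hfC : Cent f := fun a => by rw [hf, sub_mul, mul_sub, hcc]; simp
  rw [← hf] at hw1
  refine ⟨c, u1 * c + t * v, u2 * f + s * w, hc, hcc, ?_, ?_, ?_, ?_⟩
  · have : star (u1 * c + t * v) * (u1 * c + t * v) = c * (star u1 * u1) * c + c * (star u1 * (t * v)) +
      (star v * (star t * u1)) * c + star v * (star t * t) * v := by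
      simp only [star_add, star_mul, hc.1, mul_add, add_mul, mul_assoc]; abel
    rw [this, x1, y1, a1, ht, mul_one, hv1, mul_assoc, ← hcc, ← mul_assoc, hc.2]
    simp [mul_sub]
  · rw [mul_add, qtv, ← mul_assoc, qu]
  · have : star (u2 * f + s * w) * (u2 * f + s * w) = f * (star u2 * u2) * f + f * (star u2 * (s * w)) +
      (star w * (star s * u2)) * f + star w * (star s * s) * w := by
      simp only [star_add, star_mul, hfP.1, mul_add, add_mul, mul_assoc]; abel
    rw [this, x2, y2, b1, hs, mul_one, hw1, mul_assoc, ← hfC, ← mul_assoc, hfP.2, ← hf]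
    simp [mul_sub]
  · rw [mul_add, psw, ← mul_assoc, pu]

theorem Proj.nonneg {p : A} (h : Proj p) : 0 ≤ p := by
  have := star_mul_self_nonneg p
  rwa [h.1, h.2] at this

theorem invert (m c : A) (hc : Proj c) (hcc : Cent c) (h : c ≤ m) (hm : c * m = m) :
    ∃ r, star r * m * r = c := by
  have h1 : (1 : A) ≤ m + (1 - c) := by
    have := add_le_add_left h (1 - c)
    simpa using this
  have h2 : IsStrictlyPositive (m + (1 - c)) :=
    ⟨zero_le_one.trans h1, CStarAlgebra.isUnit_of_le 1 h1⟩
  set r := (m + (1 - c)) ^ (-(1 / 2) : ℝ) with hr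
  have h3 := CFC.conjugate_rpow_neg_one_half (m + (1 - c)) h2
  have h4 : star r = r := (IsSelfAdjoint.of_nonneg CFC.rpow_nonneg).star_eq
  rw [← hr] at h3
  refine ⟨r * c, ?_⟩
  have h5 : (m + (1 - c)) * c = m := by
    rw [add_mul, sub_mul, hc.2, ← hcc, hm]; simp
  have : star (r * c) * m * (r * c) = c * (r * (m + (1 - c)) * r) * c := by
    rw [star_mul, hc.1, h4]
    simp only [mul_assoc]
    rw [← hcc r]
    simp only [ra h5]
    rw [← mul_assoc m c r, ← hcc m, hm]
  rw [this, h3, mul_one, hc.2]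

theorem invert2 (m c : A) (hc : Proj c) (hcc : Cent c) (h : c ≤ m + m) (hm : c * m = m) :
    ∃ r, star r * m * r = c := by
  obtain ⟨r, hr⟩ := invert (m + m) c hc hcc h (by rw [mul_add, hm])
  refine ⟨((√2 : ℝ) : ℂ) • r, ?_⟩
  have h2 : ((√2 : ℝ) : ℂ) * ((√2 : ℝ) : ℂ) = 2 := by
    rw [← Complex.ofReal_mul, Real.mul_self_sqrt (by norm_num)]; simp
  rw [star_smul, smul_mul_assoc, smul_mul_assoc, mul_smul_comm, smul_smul]
  simp only [RCLike.star_def, Complex.conj_ofReal, h2]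
  rw [← hr, two_smul, mul_add, add_mul]

theorem claimA' (W : VecFun A) (hPI : PI A) (h k : A) (hh : 0 ≤ h) (hk : 0 ≤ k) (h1 : 1 ≤ h + k) :
    ∃ c a b : A, Proj c ∧ Cent c ∧ star a * h * a = c ∧ star b * k * b = 1 - c := by
  obtain ⟨p, hp, hp1, hp2⟩ := spectral_cut W (h - k)
    ((IsSelfAdjoint.of_nonneg hh).sub (IsSelfAdjoint.of_nonneg hk))
  obtain ⟨c, d, d', hc, hcc, hd, hpd, hd', hpd'⟩ := claimA W hPI p hp
  have hcc' : Cent (1 - c) := fun a => by rw [sub_mul, mul_sub, hcc]; simp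
  have e1 : star d' * (p * (h - k) * p) * d' = star d' * h * d' - star d' * k * d' := by
    have : star d' * p = star d' := by simpa [hp.1] using congrArg star hpd'
    rw [← mul_assoc, ← mul_assoc, this, mul_assoc _ p, hpd', mul_sub, sub_mul]
  have e2 : star d * ((1 - p) * (h - k) * (1 - p)) * d = star d * h * d - star d * k * d := by
    have : star d * (1 - p) = star d := by simpa [hp.1] using congrArg star hpd
    rw [← mul_assoc, ← mul_assoc, this, mul_assoc _ (1 - p), hpd, mul_sub, sub_mul]
  have f1 : star d' * k * d' ≤ star d' * h * d' := by
    rw [← sub_nonneg, ← e1]; exact star_left_conjugate_nonneg hp1 _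
  have f2 : star d * h * d ≤ star d * k * d := by
    have := star_left_conjugate_le_conjugate hp2 d
    rw [e2, mul_zero, zero_mul] at this
    exact sub_nonpos.1 this
  have g1 := star_left_conjugate_le_conjugate h1 d
  have g2 := star_left_conjugate_le_conjugate h1 d'
  rw [mul_one, mul_add, add_mul] at g1 g2
  rw [hd] at g1
  rw [hd'] at g2
  have m1 : d * c = d := mul_of_star_mul hd hc.2
  have m2 : d' * (1 - c) = d' := mul_of_star_mul hd' hc.compl.2
  obtain ⟨r, hr⟩ := invert2 (star d' * h * d') (1 - c) hc.compl hcc'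
    (g2.trans (add_le_add le_rfl f1)) (by rw [hcc', mul_assoc, m2])
  obtain ⟨r', hr'⟩ := invert2 (star d * k * d) c hc hcc
    (g1.trans (add_le_add f2 le_rfl)) (by rw [hcc, mul_assoc, m1])
  refine ⟨1 - c, d' * r, d * r', hc.compl, hcc', ?_, ?_⟩
  · rw [← hr]; simp only [star_mul, mul_assoc]
  · rw [sub_sub_cancel, ← hr']; simp only [star_mul, mul_assoc]

theorem lemma9 (W : VecFun A) (hPI : PI A) (h : A) (hh : 0 ≤ h)
    (h0 : ∀ c a : A, Proj c → Cent c → star a * h * a = c → c = 0) (m : A)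
    (hm : m ∈ AddSubmonoid.closure {x | ∃ a : A, x = star a * h * a}) :
    0 ≤ m ∧ ∀ b k : A, 0 ≤ k → 1 ≤ star b * m * b + k → ∃ b', star b' * k * b' = 1 := by
  induction hm using AddSubmonoid.closure_induction with
  | mem x hx =>
    obtain ⟨a, rfl⟩ := hx
    refine ⟨star_left_conjugate_nonneg hh a, fun b k hk h1 => ?_⟩
    have h2 : star b * (star a * h * a) * b = star (a * b) * h * (a * b) := by
      simp only [star_mul, mul_assoc]
    rw [h2] at h1
    obtain ⟨c, a', b', hc, hcc, ha, hb⟩ := claimA' W hPI _ k (star_left_conjugate_nonneg hh (a * b)) hk h1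
    have := h0 c (a * b * a') hc hcc (by rw [← ha]; simp only [star_mul, mul_assoc])
    exact ⟨b', by rw [hb, this, sub_zero]⟩
  | zero =>
    refine ⟨le_rfl, fun b k hk h1 => ?_⟩
    rw [mul_zero, zero_mul, zero_add] at h1
    exact invert k 1 ⟨star_one _, mul_one _⟩ (fun a => by simp) h1 (one_mul _)
  | add x y hx hy ihx ihy =>
    refine ⟨add_nonneg ihx.1 ihy.1, fun b k hk h1 => ?_⟩
    rw [mul_add, add_mul, add_assoc] at h1
    obtain ⟨b1, hb1⟩ := ihx.2 b _ (add_nonneg (star_left_conjugate_nonneg ihy.1 b) hk) h1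
    obtain ⟨b2, hb2⟩ := ihy.2 (b * b1) (star b1 * k * b1) (star_left_conjugate_nonneg hk b1) (by
      rw [← hb1, mul_add, add_mul]; simp only [star_mul, mul_assoc]; exact le_rfl)
    exact ⟨b1 * b2, by rw [← hb2]; simp only [star_mul, mul_assoc]⟩

end Abstract

section Abstract
set_option linter.unusedSectionVars false
open Filter Topology
universe v
variable {A : Type v} [CStarAlgebra A] [PartialOrder A] [StarOrderedRing A]

theorem good_max (W : VecFun A) (y : A) :
    ∃ z b : A, Proj z ∧ Cent z ∧ star b * b = z ∧ 0 ≤ star b * y * b ∧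
      ∀ z' b' : A, Proj z' → Cent z' → star b' * b' = z' → 0 ≤ star b' * y * b' → z * z' = z' := by
  let G : Set (A × A) := {r | r.2 = r.1 ∧ (star r.1 * r.1) * (star r.1 * r.1) = star r.1 * r.1 ∧
    Cent (star r.1 * r.1) ∧ 0 ≤ star r.1 * y * r.1}
  obtain ⟨m, hm, -, hmax⟩ := zorn_pair W G (fun p h => ⟨by rw [h.1], h.2.1⟩)
    (by
      intro ι U s t S T hG hev hgl
      have h1 : T = S := hgl.limT.unique (hgl.limS.congr (Eventually.of_forall fun i => (hG i).1.symm))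
      refine ⟨h1, hgl.EE, fun a => ?_, ?_⟩
      · exact (hgl.limE.mulR a).unique
          ((hgl.limE.mulL a).congr (Eventually.of_forall fun i => ((hG i).2.2.1 a).symm))
      · simp only
        have h2 := (hgl.limE.mulL (star S * y * S))
        have hSE : S * (star S * S) = S := mul_of_star_mul rfl hgl.EE
        have h3 : star S * y * S * (star S * S) = star S * y * S := by rw [mul_assoc _ S, hSE]
        rw [h3] at h2
        refine h2.nonneg fun i => ?_
        have h4 := (hG i).2.2.2
        have h5 := hgl.eS i
        have h6 := (hG i).2.2.1
        have h7 := (hG i).2.1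
        simp only at h4 h6 h7
        obtain ⟨e, he⟩ : ∃ e, star (s i) * s i = e := ⟨_, rfl⟩
        rw [he] at h5 h6 h7 ⊢
        have hes : star e = e := by rw [← he]; simp
        rw [← h5, star_mul, hes] at h4
        have : e * star S * y * (S * e) = star S * y * S * e := by
          simp only [mul_assoc]
          rw [h6]
          simp only [mul_assoc, h7]
        rwa [this] at h4)
    (0, 0) (by simp [G, Cent])
  obtain ⟨b, b'⟩ := m
  obtain ⟨h1, h2, h3, h4⟩ := hm
  simp only at h1 h2 h3 h4 hmax
  subst h1
  obtain ⟨z, he⟩ : ∃ e, star b' * b' = e := ⟨_, rfl⟩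
  rw [he] at h2 h3 hmax
  have hzP : Proj z := ⟨by rw [← he]; simp, h2⟩
  refine ⟨z, b', hzP, h3, he, h4, fun z' d hz' hc' hd hd0 => ?_⟩
  obtain ⟨f, hf⟩ : ∃ f, f = 1 - z := ⟨_, rfl⟩
  have hfP : Proj f := hf ▸ hzP.compl
  have hfC : Cent f := fun a => by rw [hf, sub_mul, mul_sub, h3]; simp
  have hbz : b' * z = b' := mul_of_star_mul he h2
  have hbf : b' * f = 0 := by rw [hf, mul_sub, mul_one, hbz, sub_self]
  have hfb : f * star b' = 0 := by simpa [hfP.1] using congrArg star hbf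
  have hcr : ∀ a, star b' * a * (d * f) = 0 := fun a => by
    rw [← hfC d, ← mul_assoc, mul_assoc (star b'), ← hfC a, ← mul_assoc, ← hfC (star b'), hfb]; simp
  have hcr' : ∀ a, star (d * f) * a * b' = 0 := fun a => by
    have := congrArg star (hcr (star a))
    simpa [mul_assoc] using this
  have k1 : star (b' + d * f) * (b' + d * f) = z + f * z' := by
    have c1 := hcr 1
    have c2 := hcr' 1
    rw [mul_one] at c1 c2
    rw [star_add, mul_add, add_mul, add_mul, c1, c2, he, star_mul, hfP.1, mul_assoc, ← mul_assoc (star d),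
      hd, hc', ← mul_assoc, hfP.2, ← hc']
    simp [hc' f]
  have hzf : z * f = 0 := by rw [hf, mul_sub, mul_one, h2, sub_self]
  have hfz : f * z = 0 := by rw [hfC, hzf]
  have := hmax (b' + d * f, b' + d * f) ⟨rfl, by
      simp only [k1]
      have e1 : f * z' * (f * z') = f * z' := by
        rw [mul_assoc, ← mul_assoc z', hc' f, mul_assoc f z', hz'.2, ← mul_assoc, hfP.2]
      have e2 : f * z' * z = 0 := by rw [mul_assoc, hc', ← mul_assoc, hfz, zero_mul]
      rw [mul_add, add_mul, add_mul, h2, e1, e2, ← mul_assoc, hzf]; simp, by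
      simp only [k1]
      intro a
      rw [add_mul, mul_add, h3, mul_assoc, hc', ← mul_assoc, hfC, mul_assoc], by
      simp only
      have : star (b' + d * f) * y * (b' + d * f) = star b' * y * b' + star f * (star d * y * d) * f := by
        have c1 := hcr y
        have c2 := hcr' y
        rw [star_add, add_mul, mul_add, add_mul, add_mul, c1, c2]
        simp [mul_assoc]
      rw [this]
      exact add_nonneg h4 (star_left_conjugate_nonneg hd0 _)⟩
    ⟨by simp only [he]; rw [add_mul, hbz, mul_assoc, hfz]; simp,
     by simp only [he]; rw [add_mul, hbz, mul_assoc, hfz]; simp⟩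
  simp only [k1] at this
  have h5 : f * z' = 0 := by simpa using this
  rw [hf, sub_mul, one_mul, sub_eq_zero] at h5
  exact h5.symm

/-- closed ideals -/
def CIdeal (J : Set A) : Prop :=
  IsClosed J ∧ (0 : A) ∈ J ∧ (∀ x ∈ J, ∀ y ∈ J, x + y ∈ J) ∧
    (∀ (c : ℂ), ∀ x ∈ J, c • x ∈ J) ∧ (∀ (a : A), ∀ x ∈ J, a * x ∈ J ∧ x * a ∈ J)

def MIdeal (N : Set A) : Prop :=
  CIdeal N ∧ N ≠ Set.univ ∧
    ∀ N' : Set A, CIdeal N' → N' ≠ Set.univ → N ⊆ N' → N' = N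

theorem CIdeal.closure {T : Set A} (h0 : (0 : A) ∈ T) (ha : ∀ x ∈ T, ∀ y ∈ T, x + y ∈ T)
    (hs : ∀ (c : ℂ), ∀ x ∈ T, c • x ∈ T) (hm : ∀ (a : A), ∀ x ∈ T, a * x ∈ T ∧ x * a ∈ T) :
    CIdeal (_root_.closure T) := by
  refine ⟨isClosed_closure, subset_closure h0, fun x hx y hy => ?_, fun c x hx => ?_, fun a x hx => ⟨?_, ?_⟩⟩
  · exact map_mem_closure₂ continuous_add hx hy ha
  · exact map_mem_closure (continuous_const_smul c) hx (hs c)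
  · exact map_mem_closure (continuous_const_mul a) hx (fun y hy => (hm a y hy).1)
  · exact map_mem_closure (f := fun y => y * a) (continuous_mul_const a) hx (fun y hy => (hm a y hy).2)

theorem CIdeal.one_notMem {N : Set A} (h : CIdeal N) (h1 : N ≠ Set.univ) : (1 : A) ∉ N := fun h' =>
  h1 (Set.eq_univ_of_forall fun a => by simpa using (h.2.2.2.2 a 1 h').1)

theorem le_one_of_norm {a : A} (ha : IsSelfAdjoint a) (h : ‖a‖ ≤ 1) : a ≤ 1 := by
  have h1 := ha.le_algebraMap_norm_self
  refine h1.trans ?_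
  have := algebraMap_mono A h
  simpa using this

theorem mem_max (W : VecFun A) (hPI : PI A) (h : A) (hh : 0 ≤ h)
    (h0 : ∀ c a : A, Proj c → Cent c → star a * h * a = c → c = 0) (N : Set A) (hN : MIdeal N) :
    h ∈ N := by
  by_contra hhN
  obtain ⟨hNI, hNu, hNm⟩ := hN
  obtain ⟨-, n0, nadd, nsmul, nmul⟩ := id hNI
  let T : AddSubmonoid A := AddSubmonoid.closure ({x | ∃ a b : A, x = a * h * b} ∪ N)
  have hT : CIdeal (closure (T : Set A)) := by
    refine CIdeal.closure T.zero_mem (fun x hx y hy => T.add_mem hx hy) (fun c x hx => ?_)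
      (fun a x hx => ⟨?_, ?_⟩)
    · induction hx using AddSubmonoid.closure_induction with
      | mem x hx =>
        refine AddSubmonoid.subset_closure ?_
        rcases hx with ⟨a, b, rfl⟩ | hx
        · exact Or.inl ⟨c • a, b, by simp⟩
        · exact Or.inr (nsmul c x hx)
      | zero => simp
      | add x y _ _ hx hy => rw [smul_add]; exact T.add_mem hx hy
    · induction hx using AddSubmonoid.closure_induction with
      | mem x hx =>
        refine AddSubmonoid.subset_closure ?_
        rcases hx with ⟨a', b, rfl⟩ | hx
        · exact Or.inl ⟨a * a', b, by simp [mul_assoc]⟩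
        · exact Or.inr (nmul a x hx).1
      | zero => simp
      | add x y _ _ hx hy => rw [mul_add]; exact T.add_mem hx hy
    · induction hx using AddSubmonoid.closure_induction with
      | mem x hx =>
        refine AddSubmonoid.subset_closure ?_
        rcases hx with ⟨a', b, rfl⟩ | hx
        · exact Or.inl ⟨a', b * a, by simp [mul_assoc]⟩
        · exact Or.inr (nmul a x hx).2
      | zero => simp
      | add x y _ _ hx hy => rw [add_mul]; exact T.add_mem hx hy
  have hNT : N ⊆ closure (T : Set A) := fun x hx =>
    subset_closure (AddSubmonoid.subset_closure (Or.inr hx))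
  have hhT : h ∈ closure (T : Set A) :=
    subset_closure (AddSubmonoid.subset_closure (Or.inl ⟨1, 1, by simp⟩))
  have hu : closure (T : Set A) = Set.univ := by
    by_contra hne
    have := hNm _ hT hne hNT
    rw [this] at hhT
    exact hhN hhT
  have h1 : (1 : A) ∈ closure (T : Set A) := by rw [hu]; trivial
  obtain ⟨d, hd, hd1⟩ := Metric.mem_closure_iff.1 h1 (1 / 2) (by norm_num)
  rw [dist_eq_norm] at hd1
  have key : ∀ d ∈ T, ∃ m ∈ AddSubmonoid.closure {x | ∃ a : A, x = star a * h * a}, ∃ y ∈ N,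
      d + star d ≤ m + (y + star y) := by
    intro d hd
    induction hd using AddSubmonoid.closure_induction with
    | mem x hx =>
      rcases hx with ⟨a, b, rfl⟩ | hx
      · refine ⟨star (star a) * h * star a + star b * h * b, AddSubmonoid.add_mem _
          (AddSubmonoid.subset_closure ⟨_, rfl⟩) (AddSubmonoid.subset_closure ⟨_, rfl⟩), 0, n0, ?_⟩
        have := star_left_conjugate_nonneg hh (star a - b)
        rw [← sub_nonneg]
        convert this using 1
        simp only [star_sub, star_star, star_mul, sub_mul, mul_sub, mul_assoc,
          (IsSelfAdjoint.of_nonneg hh).star_eq, star_zero, add_zero]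
        abel
      · exact ⟨0, AddSubmonoid.zero_mem _, x, hx, by simp⟩
    | zero => exact ⟨0, AddSubmonoid.zero_mem _, 0, n0, by simp⟩
    | add x y _ _ hx hy =>
      obtain ⟨m1, hm1, y1, hy1, h1⟩ := hx
      obtain ⟨m2, hm2, y2, hy2, h2⟩ := hy
      refine ⟨m1 + m2, AddSubmonoid.add_mem _ hm1 hm2, y1 + y2, nadd _ hy1 _ hy2, ?_⟩
      have := add_le_add h1 h2
      simp only [star_add]
      convert this using 1 <;> abel
  obtain ⟨m, hm, y, hy, hle⟩ := key d hd
  have hle2 : (1 - d) + star (1 - d) ≤ 1 := by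
    refine le_one_of_norm (IsSelfAdjoint.add_star_self _) ?_
    refine (norm_add_le _ _).trans ?_
    rw [norm_star]; linarith
  have hsq := star_mul_self_nonneg (1 - (y + y))
  have hfin : 1 ≤ star (1 : A) * (m + m) * 1 + star (y + y) * (y + y) := by
    have e1 := add_le_add (add_le_add (add_le_add hle hle) (add_le_add hle2 hle2)) hsq
    rw [← sub_nonneg] at e1 ⊢
    convert e1 using 1
    simp only [star_sub, star_add, star_one, sub_mul, mul_sub, one_mul, mul_one]
    abel
  obtain ⟨b, hb⟩ := (lemma9 W hPI h hh h0 (m + m) (AddSubmonoid.add_mem _ hm hm)).2 1 _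
    (star_mul_self_nonneg (y + y)) hfin
  refine hNI.one_notMem hNu ?_
  rw [← hb]
  exact (nmul _ _ (nmul _ _ (nmul _ _ (nadd _ hy _ hy)).1).1).2

theorem good (W : VecFun A) (hPI : PI A) (y : A) :
    ∃ z b : A, Proj z ∧ Cent z ∧ star b * b = z ∧ 0 ≤ star b * y * b ∧
      (∀ z' b' : A, Proj z' → Cent z' → star b' * b' = z' → 0 ≤ star b' * y * b' → z * z' = z') ∧
      (IsSelfAdjoint y → ∀ N, MIdeal N → (1 - z) * y⁺ ∈ N) := by
  obtain ⟨z, b, hz, hc, hb, hb0, hmax⟩ := good_max W y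
  refine ⟨z, b, hz, hc, hb, hb0, hmax, fun hy N hN => ?_⟩
  obtain ⟨f, hf⟩ : ∃ f, f = 1 - z := ⟨_, rfl⟩
  have hfP : Proj f := hf ▸ hz.compl
  have hfC : Cent f := fun a => by rw [hf, sub_mul, mul_sub, hc]; simp
  rw [← hf]
  have hh : 0 ≤ f * y⁺ := by
    have := star_left_conjugate_nonneg (CFC.posPart_nonneg y) f
    rwa [hfP.1, mul_assoc, ← hfC, ← mul_assoc, hfP.2] at this
  refine mem_max W hPI _ hh (fun c a hcP hcC ha => ?_) N hN
  have hfc : f * c = c := by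
    rw [← ha, ← mul_assoc, ← mul_assoc, hfC, mul_assoc (star a), ← mul_assoc f f, hfP.2]
  set r := CFC.sqrt (f * y⁺) with hr
  have hrr : r * r = f * y⁺ := CFC.sqrt_mul_sqrt_self _ hh
  have hrs : star r = r := (IsSelfAdjoint.of_nonneg (CFC.sqrt_nonneg _)).star_eq
  have hny : star (y⁻) = y⁻ := (IsSelfAdjoint.of_nonneg (CFC.negPart_nonneg y)).star_eq
  have hr0 : r * y⁻ = 0 := by
    apply star_mul_self_zero
    rw [star_mul, hrs, mul_assoc, ← mul_assoc r, hrr, mul_assoc f, CFC.posPart_mul_negPart]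
    simp
  have hryr : 0 ≤ r * y * r := by
    have h1 := star_left_conjugate_nonneg (CFC.posPart_nonneg y) r
    rw [hrs] at h1
    have : r * y * r = r * y⁺ * r := by
      nth_rw 1 [← CFC.posPart_sub_negPart y hy]
      rw [mul_sub, hr0, sub_zero]
    rwa [this]
  have := hmax c (r * a) hcP hcC (by
    rw [← ha, ← hrr, star_mul, hrs]; simp only [mul_assoc]) (by
    have := star_left_conjugate_nonneg hryr a
    rw [star_mul, hrs]
    simpa only [mul_assoc] using this)
  rw [hf, sub_mul, one_mul, this, sub_self] at hfc
  exact hfc.symm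

end Abstract

section Abstract
set_option linter.unusedSectionVars false
open Filter Topology
universe v
variable {A : Type v} [CStarAlgebra A] [PartialOrder A] [StarOrderedRing A]

def SR (A : Type v) [CStarAlgebra A] : Set A := ⋂₀ {N : Set A | MIdeal N}

def St (ω : A →L[ℂ] ℂ) : Prop := (∀ a : A, 0 ≤ ω (star a * a)) ∧ ω 1 = 1

theorem St.nonneg {ω : A →L[ℂ] ℂ} (h : St ω) {a : A} (ha : 0 ≤ a) : 0 ≤ ω a := by
  obtain ⟨r, rfl⟩ := CStarAlgebra.nonneg_iff_eq_star_mul_self.1 ha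
  exact h.1 r

theorem St.mono {ω : A →L[ℂ] ℂ} (h : St ω) {a b : A} (hab : a ≤ b) : (ω a).re ≤ (ω b).re := by
  have := h.nonneg (sub_nonneg.2 hab)
  rw [map_sub, sub_nonneg] at this
  exact (Complex.le_def.1 this).1

theorem St.im_eq {ω : A →L[ℂ] ℂ} (h : St ω) {a : A} (ha : IsSelfAdjoint a) : (ω a).im = 0 := by
  have h1 := Complex.le_def.1 (h.nonneg (CFC.posPart_nonneg a))
  have h2 := Complex.le_def.1 (h.nonneg (CFC.negPart_nonneg a))
  rw [← CFC.posPart_sub_negPart a ha, map_sub, Complex.sub_im, ← h1.2, ← h2.2]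
  simp

theorem St.star {ω : A →L[ℂ] ℂ} (h : St ω) (a : A) : ω (star a) = conj (ω a) := by
  have h1 := h.im_eq (IsSelfAdjoint.add_star_self a)
  have h2 := h.im_eq (a := Complex.I • (a - Star.star a)) (by
    rw [IsSelfAdjoint, star_smul, star_sub, star_star]
    simp [← smul_neg])
  simp only [map_add, map_smul, map_sub, smul_eq_mul, Complex.add_im, Complex.mul_im, Complex.I_re,
    Complex.I_im, Complex.sub_re, Complex.sub_im] at h1 h2
  apply Complex.ext
  · simp; linarith
  · simp; linarith

theorem St.conj_isom {ω : A →L[ℂ] ℂ} (h : St ω) {b : A} (hb : Star.star b * b = 1) (x : A) :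
    ‖ω (Star.star b * x * b)‖ ^ 2 ≤ (ω (Star.star b * (Star.star x * x) * b)).re := by
  set l := ω (Star.star b * x * b) with hl
  have h1 := h.1 ((x - l • 1) * b)
  have h3 : ω (Star.star b * Star.star x * b) = conj l := by
    rw [hl, ← h.star]; simp [mul_assoc]
  have h2 : Star.star ((x - l • 1) * b) * ((x - l • 1) * b) = Star.star b * (Star.star x * x) * b
      - l • (Star.star b * Star.star x * b) - conj l • (Star.star b * x * b) + (conj l * l) • 1 := by
    rw [star_mul, star_sub, star_smul, star_one]
    simp only [sub_mul, mul_sub, smul_mul_assoc, mul_smul_comm, one_mul, mul_one, mul_assoc, hb,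
      smul_sub, smul_smul, RCLike.star_def]
    rw [mul_comm l (conj l)]
    abel
  rw [h2, map_add, map_sub, map_sub, map_smul, map_smul, map_smul, ← hl, h.2, h3] at h1
  have h4 := (Complex.le_def.1 h1).1
  simp only [smul_eq_mul, Complex.add_re, Complex.sub_re, Complex.mul_re, Complex.conj_re,
    Complex.conj_im, Complex.zero_re, mul_one] at h4
  rw [Complex.sq_norm, Complex.normSq_apply]
  linarith

theorem pos_shift (x : A) (hx : IsSelfAdjoint x) (l : ℝ) :
    (x - algebraMap ℝ A l)⁺ = cfc (fun t : ℝ => max (t - l) 0) x := by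
  rw [CFC.posPart_def, cfcₙ_eq_cfc]
  have h1 : x - algebraMap ℝ A l = cfc (fun t : ℝ => t - l) x := by
    rw [cfc_sub _ _ x, cfc_id' ℝ x, cfc_const l x]
  rw [h1, ← cfc_comp' (fun t : ℝ => t⁺) (fun t : ℝ => t - l) x]
  rfl

theorem pos_step (x : A) (hx : IsSelfAdjoint x) (l δ : ℝ) (hδ : 0 ≤ δ) :
    (x - algebraMap ℝ A l)⁺ ≤ algebraMap ℝ A δ + (x - algebraMap ℝ A (l + δ))⁺ := by
  rw [pos_shift x hx, pos_shift x hx, ← cfc_const δ x, ← cfc_add ..]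
  refine cfc_mono fun t _ => ?_
  rcases le_total (t - l) 0 with h | h
  · rw [max_eq_right h]
    exact add_nonneg hδ (le_max_right _ _)
  · rw [max_eq_left h]
    have := le_max_left (t - (l + δ)) 0
    linarith

theorem Proj.le_one {p : A} (h : Proj p) : p ≤ 1 := sub_nonneg.1 h.compl.nonneg

theorem cent_conj {z : A} (hz : Proj z) (hc : Cent z) {a : A} (ha : 0 ≤ a) : 0 ≤ z * a := by
  have := star_left_conjugate_nonneg ha z
  rwa [hz.1, mul_assoc, ← hc, ← mul_assoc, hz.2] at this

theorem Cent.one_sub {z : A} (h : Cent z) : Cent (1 - z) := fun a => by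
  rw [sub_mul, mul_sub, h]; simp

theorem key_bound (W : VecFun A) (hPI : PI A) (ω ρ : A →L[ℂ] ℂ) (hω : St ω) (hρ : St ρ)
    (hJ : ∀ x ∈ SR A, ω x = 0) (hC : ∀ c : A, Cent c → ω c = ρ c) (x : A) (hx : 0 ≤ x) (δ : ℝ)
    (hδ : 0 < δ) : ∃ b : A, star b * b = 1 ∧ (ω x).re ≤ (ρ (star b * x * b)).re + δ := by
  have hxs : IsSelfAdjoint x := IsSelfAdjoint.of_nonneg hx
  choose z b hz hzc hb hb0 hmax hN using fun k : ℕ => good W hPI (x - algebraMap ℝ A (k * δ))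
  have hys : ∀ k : ℕ, IsSelfAdjoint (x - algebraMap ℝ A (k * δ)) := fun k =>
    hxs.sub (IsSelfAdjoint.algebraMap A (IsSelfAdjoint.all _))
  have hJk : ∀ k, ω ((1 - z k) * (x - algebraMap ℝ A (k * δ))⁺) = 0 := fun k =>
    hJ _ (Set.mem_sInter.2 fun N hN' => hN k (hys k) N hN')
  have up : ∀ n : ℕ, (ω x).re ≤ δ * ∑ k ∈ Finset.range n, (ω (z k)).re +
      (ω ((x - algebraMap ℝ A (n * δ))⁺)).re := by
    intro n
    induction n with
    | zero =>
      simp only [Finset.range_zero, Finset.sum_empty, mul_zero, zero_add, Nat.cast_zero, zero_mul, map_zero,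
        sub_zero]
      refine hω.mono ?_
      rw [← sub_nonneg]
      nth_rw 2 [← CFC.posPart_sub_negPart x hxs]
      simpa using CFC.negPart_nonneg x
    | succ n ih =>
      refine ih.trans ?_
      rw [Finset.sum_range_succ, mul_add, add_assoc, add_le_add_iff_left]
      have e1 : ω ((x - algebraMap ℝ A (n * δ))⁺) = ω (z n * (x - algebraMap ℝ A (n * δ))⁺) := by
        have := hJk n
        rw [sub_mul, one_mul, map_sub, sub_eq_zero] at this
        exact this
      have e2 : z n * (x - algebraMap ℝ A (n * δ))⁺ ≤ δ • z n +
          (x - algebraMap ℝ A ((n + 1 : ℕ) * δ))⁺ := by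
        have h1 := pos_step x hxs (n * δ) δ hδ.le
        have h2 : (n : ℝ) * δ + δ = (n + 1 : ℕ) * δ := by push_cast; ring
        rw [h2] at h1
        have h3 := cent_conj (hz n) (hzc n) (sub_nonneg.2 h1)
        have h4 := cent_conj (hz n).compl (hzc n).one_sub
          (CFC.posPart_nonneg (x - algebraMap ℝ A ((n + 1 : ℕ) * δ)))
        have h5 := add_nonneg h3 h4
        rw [← sub_nonneg]
        convert h5 using 1
        rw [Algebra.algebraMap_eq_smul_one (R := ℝ) (A := A) δ]
        simp only [mul_sub, mul_add, sub_mul, mul_smul_comm, mul_one, one_mul]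
        abel
      have e3 := hω.mono e2
      rw [e1]
      rw [map_add, Complex.add_re] at e3
      refine e3.trans (le_of_eq ?_)
      congr 1
      have : δ • z n = (δ : ℂ) • z n := by rw [Complex.coe_smul]
      rw [this, map_smul, smul_eq_mul, Complex.re_ofReal_mul]
  have lo : ∀ n : ℕ, ∃ B : A, star B * B = 1 ∧
      δ • ∑ k ∈ Finset.range n, z (k + 1) ≤ star B * x * B := by
    intro n
    induction n with
    | zero => exact ⟨1, by simp, by simpa using hx⟩
    | succ n ih =>
      obtain ⟨B, hB1, hB2⟩ := ih
      obtain ⟨w, hw⟩ : ∃ w, w = z (n + 1) := ⟨_, rfl⟩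
      obtain ⟨d, hd⟩ : ∃ d, d = b (n + 1) := ⟨_, rfl⟩
      have hwP : Proj w := hw ▸ hz _
      have hwC : Cent w := hw ▸ hzc _
      have hdw : star d * d = w := by rw [hd, hw, hb]
      have hd0 := hb0 (n + 1)
      rw [← hd] at hd0
      have hzw : ∀ k ≤ n, z k * w = w := by
        intro k hk
        refine hmax k w d hwP hwC hdw ?_
        refine hd0.trans (star_left_conjugate_le_conjugate ?_ d)
        refine sub_le_sub_left (algebraMap_mono A ?_) x
        gcongr
        omega
      have dw : d * w = d := mul_of_star_mul hdw hwP.2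
      have wd : w * star d = star d := by simpa [hwP.1] using congrArg star dw
      have hcr : ∀ a, star d * a * (B * (1 - w)) = 0 := fun a => by
        rw [← hwC.one_sub B, ← mul_assoc, mul_assoc (star d), ← hwC.one_sub a, ← mul_assoc,
          ← hwC.one_sub, sub_mul, wd]; simp
      have hcr' : ∀ a, star (B * (1 - w)) * a * d = 0 := fun a => by
        have := congrArg star (hcr (star a))
        simpa [mul_assoc] using this
      have hex : ∀ a, star (B * (1 - w) + d) * a * (B * (1 - w) + d) =
          (1 - w) * (star B * a * B) + star d * a * d := fun a => by
        rw [star_add, add_mul, mul_add, add_mul, add_mul, hcr, hcr', star_mul, hwP.compl.1, zero_add,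
          add_zero]
        congr 1
        have : (1 - w) * star B * a * (B * (1 - w)) = (1 - w) * (star B * a * B) * (1 - w) := by
          simp only [mul_assoc]
        rw [this, ← hwC.one_sub, ← mul_assoc, hwP.compl.2]
      refine ⟨B * (1 - w) + d, ?_, ?_⟩
      · have := hex 1
        rw [mul_one, mul_one, mul_one, hB1, hdw] at this
        rw [this]; simp
      · rw [hex]
        have h1 : δ • ∑ k ∈ Finset.range (n + 1), z (k + 1) =
            (1 - w) * (δ • ∑ k ∈ Finset.range n, z (k + 1)) + ((n + 1 : ℕ) * δ) • w := by
          rw [Finset.sum_range_succ, ← hw, sub_mul, one_mul, mul_smul_comm, Finset.mul_sum]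
          have : ∑ k ∈ Finset.range n, w * z (k + 1) = (n : ℝ) • w := by
            rw [Finset.sum_congr rfl (g := fun _ => w)]
            · simp [← Nat.cast_smul_eq_nsmul ℝ]
            · intro k hk
              rw [hwC, hzw]
              have := Finset.mem_range.1 hk
              omega
          rw [this, smul_add, smul_smul]
          push_cast
          rw [add_mul, one_mul, add_smul, mul_comm δ]
          abel
        rw [h1]
        refine add_le_add ?_ ?_
        · have := cent_conj hwP.compl hwC.one_sub (sub_nonneg.2 hB2)
          rw [mul_sub, sub_nonneg] at this
          exact this
        · rw [mul_sub, sub_mul, sub_nonneg, Algebra.algebraMap_eq_smul_one, mul_smul_comm, smul_mul_assoc,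
            mul_one, hdw] at hd0
          exact hd0
  obtain ⟨n, hn⟩ := exists_nat_ge (‖x‖ / δ)
  have hn' : ‖x‖ ≤ n * δ := by rwa [div_le_iff₀ hδ] at hn
  have hzero : (x - algebraMap ℝ A (n * δ))⁺ = 0 := by
    rw [CFC.posPart_eq_zero_iff _ (hys n), sub_nonpos]
    exact hxs.le_algebraMap_norm_self.trans (algebraMap_mono A hn')
  obtain ⟨B, hB1, hB2⟩ := lo n
  refine ⟨B, hB1, ?_⟩
  have u1 := up (n + 1)
  have hz1 : ∀ k, (ω (z k)).re ≤ 1 := fun k => by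
    have := hω.mono (hz k).le_one
    rwa [hω.2, Complex.one_re] at this
  have hz0 : ∀ k, 0 ≤ (ω (z k)).re := fun k => (Complex.le_def.1 (hω.nonneg (hz k).nonneg)).1
  have hzero' : (x - algebraMap ℝ A ((n + 1 : ℕ) * δ))⁺ = 0 := by
    rw [CFC.posPart_eq_zero_iff _ (hys (n + 1)), sub_nonpos]
    refine hxs.le_algebraMap_norm_self.trans (algebraMap_mono A (hn'.trans ?_))
    push_cast; nlinarith
  rw [hzero', map_zero, Complex.zero_re, add_zero, Finset.sum_range_succ'] at u1
  have l1 := hρ.mono hB2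
  have : δ • ∑ k ∈ Finset.range n, z (k + 1) = (δ : ℂ) • ∑ k ∈ Finset.range n, z (k + 1) := by
    rw [Complex.coe_smul]
  rw [this, map_smul, smul_eq_mul, Complex.re_ofReal_mul, map_sum, Complex.re_sum] at l1
  have l2 : ∑ k ∈ Finset.range n, (ρ (z (k + 1))).re = ∑ k ∈ Finset.range n, (ω (z (k + 1))).re :=
    Finset.sum_congr rfl fun k _ => by rw [hC _ (hzc _)]
  rw [l2] at l1
  have := hz1 0
  nlinarith

end Abstract

section Abstract
set_option linter.unusedSectionVars false
open Filter Topology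
universe v
variable {A : Type v} [CStarAlgebra A] [PartialOrder A] [StarOrderedRing A]

theorem key_bound' (W : VecFun A) (hPI : PI A) (ω ρ : A →L[ℂ] ℂ) (hω : St ω) (hρ : St ρ)
    (hJ : ∀ x ∈ SR A, ω x = 0) (hC : ∀ c : A, Cent c → ω c = ρ c) (x : A) (hx : IsSelfAdjoint x) (δ : ℝ)
    (hδ : 0 < δ) : ∃ b : A, star b * b = 1 ∧ (ω x).re ≤ (ρ (star b * x * b)).re + δ := by
  obtain ⟨b, hb, h⟩ := key_bound W hPI ω ρ hω hρ hJ hC (x + algebraMap ℝ A ‖x‖) (by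
    have := hx.neg.le_algebraMap_norm_self
    rw [norm_neg] at this
    have := add_le_add_right this x
    simpa using this) δ hδ
  refine ⟨b, hb, ?_⟩
  have e : algebraMap ℝ A ‖x‖ = (‖x‖ : ℂ) • 1 := by
    rw [Algebra.algebraMap_eq_smul_one, Complex.coe_smul]
  rw [e, mul_add, add_mul, mul_smul_comm, smul_mul_assoc, mul_one, hb, map_add, map_add, map_smul, map_smul,
    hω.2, hρ.2, Complex.add_re, Complex.add_re] at h
  linarith

def EU (φ : A →L[ℂ] A) : Prop :=
  ∃ (n : ℕ) (a : Fin n → A), (∑ i, star (a i) * a i) = 1 ∧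
    ∀ x : A, φ x = ∑ i, star (a i) * x * a i

def mixS (ω : A →L[ℂ] ℂ) : Set (A →L[ℂ] ℂ) :=
  {ρ | ∃ φ : A →L[ℂ] A, EU φ ∧ ρ = ω.comp φ}

def WSC (S : Set (A →L[ℂ] ℂ)) (ρ : A →L[ℂ] ℂ) : Prop :=
  ∀ ε : ℝ, 0 < ε → ∀ (n : ℕ) (x : Fin n → A), ∃ σ ∈ S, ∀ i, ‖ρ (x i) - σ (x i)‖ < ε

/-- conjugation by `b` as a continuous linear map -/
def conjMap (b : A) : A →L[ℂ] A :=
  (ContinuousLinearMap.mul ℂ A (star b)).comp ((ContinuousLinearMap.mul ℂ A).flip b)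

theorem conjMap_apply (b x : A) : conjMap b x = star b * x * b := by
  simp [conjMap, mul_assoc]

theorem EU_conj {b : A} (hb : star b * b = 1) : EU (conjMap b) :=
  ⟨1, fun _ => b, by simpa using hb, fun x => by simp [conjMap_apply]⟩

theorem EU.convex {φ ψ : A →L[ℂ] A} (hφ : EU φ) (hψ : EU ψ) {s t : ℝ} (hs : 0 ≤ s) (ht : 0 ≤ t)
    (hst : s + t = 1) : EU ((s : ℂ) • φ + (t : ℂ) • ψ) := by
  obtain ⟨n, a, ha, ha'⟩ := hφ
  obtain ⟨m, b, hb, hb'⟩ := hψ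
  have key : ∀ (r : ℝ), 0 ≤ r → ∀ a x : A, star (((√r : ℝ) : ℂ) • a) * x * (((√r : ℝ) : ℂ) • a) =
      (r : ℂ) • (star a * x * a) := by
    intro r hr a x
    rw [star_smul, smul_mul_assoc, smul_mul_assoc, mul_smul_comm, smul_smul]
    simp only [RCLike.star_def, Complex.conj_ofReal]
    rw [← Complex.ofReal_mul, Real.mul_self_sqrt hr]
  have key2 : ∀ x, ∑ i, star (Fin.append (fun i => ((√s : ℝ) : ℂ) • a i) (fun i => ((√t : ℝ) : ℂ) • b i) i)
      * x * (Fin.append (fun i => ((√s : ℝ) : ℂ) • a i) (fun i => ((√t : ℝ) : ℂ) • b i) i) =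
      (s : ℂ) • (∑ i, star (a i) * x * a i) + (t : ℂ) • (∑ i, star (b i) * x * b i) := by
    intro x
    rw [Fin.sum_univ_add]
    simp only [Fin.append_left, Fin.append_right, key s hs, key t ht, Finset.smul_sum]
  refine ⟨n + m, Fin.append (fun i => ((√s : ℝ) : ℂ) • a i) (fun i => ((√t : ℝ) : ℂ) • b i), ?_, ?_⟩
  · have := key2 1
    simp only [mul_one] at this
    rw [this, ha, hb, ← add_smul, ← Complex.ofReal_add, hst]
    simp
  · intro x
    rw [key2]
    simp [ha', hb']

theorem mix_approx (W : VecFun A) (hPI : PI A) (ω ρ : A →L[ℂ] ℂ) (hω : St ω) (hρ : St ρ)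
    (hJ : ∀ x ∈ SR A, ω x = 0) (hC : ∀ c : A, Cent c → ω c = ρ c) : WSC (mixS ρ) ω := by
  intro ε hε n x
  let C : Set (Fin n → ℂ) := {v | ∃ σ ∈ mixS ρ, v = fun i => σ (x i)}
  have hconv : Convex ℝ C := by
    rintro v ⟨_, ⟨φ, hφ, rfl⟩, rfl⟩ w ⟨_, ⟨ψ, hψ, rfl⟩, rfl⟩ s t hs ht hst
    refine ⟨_, ⟨_, hφ.convex hψ hs ht hst, rfl⟩, ?_⟩
    ext i
    simp
  have hmem : (fun i => ω (x i)) ∈ closure C := by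
    by_contra hne
    obtain ⟨f, u, hf1, hf2⟩ := RCLike.geometric_hahn_banach_closed_point (𝕜 := ℂ) hconv.closure
      isClosed_closure hne
    let c : Fin n → ℂ := fun i => f (Pi.single i 1)
    have hf : ∀ σ : A →L[ℂ] ℂ, f (fun i => σ (x i)) = σ (∑ i, c i • x i) := by
      intro σ
      have : (fun i => σ (x i)) = ∑ i, σ (x i) • (Pi.single i (1 : ℂ) : Fin n → ℂ) := by
        ext j
        simp [Finset.sum_apply, Pi.single_apply]
      rw [this, map_sum, map_sum]
      refine Finset.sum_congr rfl fun i _ => ?_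
      rw [map_smul, map_smul, smul_eq_mul, smul_eq_mul, mul_comm]
    set y := ∑ i, c i • x i with hy
    rw [hf] at hf2
    obtain ⟨b, hb, hle⟩ := key_bound' W hPI ω ρ hω hρ hJ hC (y + star y) (IsSelfAdjoint.add_star_self y)
      ((ω y).re - u) (sub_pos.2 hf2)
    have h3 := hf1 (fun i => (ρ.comp (conjMap b)) (x i)) (subset_closure ⟨_, ⟨_, EU_conj hb, rfl⟩, rfl⟩)
    rw [hf] at h3
    simp only [ContinuousLinearMap.comp_apply, conjMap_apply, RCLike.re_eq_complex_re] at h3 hf2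
    have e1 : (ω (y + star y)).re = 2 * (ω y).re := by
      rw [map_add, hω.star, Complex.add_re, Complex.conj_re]; ring
    have e2 : (ρ (star b * (y + star y) * b)).re = 2 * (ρ (star b * y * b)).re := by
      have : star b * star y * b = star (star b * y * b) := by simp [mul_assoc]
      rw [mul_add, add_mul, map_add, this, hρ.star, Complex.add_re, Complex.conj_re]; ring
    rw [e1, e2] at hle
    linarith
  obtain ⟨v, ⟨σ, hσ, rfl⟩, hd⟩ := Metric.mem_closure_iff.1 hmem ε hε
  refine ⟨σ, hσ, fun i => ?_⟩
  rw [← dist_eq_norm]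
  exact (dist_le_pi_dist _ _ i).trans_lt hd

theorem MIdeal.sum_mem {N : Set A} (hN : CIdeal N) {ι : Type*} (s : Finset ι) (f : ι → A)
    (h : ∀ i ∈ s, f i ∈ N) : ∑ i ∈ s, f i ∈ N := by
  induction s using Finset.cons_induction with
  | empty => simpa using hN.2.1
  | cons a s ha ih =>
    rw [Finset.sum_cons]
    exact hN.2.2.1 _ (h _ (Finset.mem_cons_self _ _)) _ (ih fun i hi => h i (Finset.mem_cons_of_mem hi))

theorem EU.SR {φ : A →L[ℂ] A} (hφ : EU φ) {x : A} (hx : x ∈ SR A) : φ x ∈ SR A := by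
  obtain ⟨n, a, -, ha⟩ := hφ
  rw [ha]
  refine Set.mem_sInter.2 fun N hN => MIdeal.sum_mem hN.1 _ _ fun i _ => ?_
  exact (hN.1.2.2.2.2 _ _ (hN.1.2.2.2.2 _ _ (Set.mem_sInter.1 hx N hN)).1).2

theorem eq_zero_of_approx {z : ℂ} (h : ∀ ε : ℝ, 0 < ε → ‖z‖ < ε) : z = 0 := by
  by_contra h0
  exact lt_irrefl _ (h ‖z‖ (norm_pos_iff.2 h0))

theorem WSC.vanish {ω ρ : A →L[ℂ] ℂ} (h : WSC (mixS ω) ρ) (hJ : ∀ x ∈ SR A, ω x = 0) :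
    ∀ x ∈ SR A, ρ x = 0 := by
  intro x hx
  refine eq_zero_of_approx fun ε hε => ?_
  obtain ⟨σ, ⟨φ, hφ, rfl⟩, h1⟩ := h ε hε 1 fun _ => x
  have := h1 0
  rwa [ContinuousLinearMap.comp_apply, hJ _ (hφ.SR hx), sub_zero] at this

theorem WSC.cent {ω ρ : A →L[ℂ] ℂ} (h : WSC (mixS ω) ρ) : ∀ c : A, Cent c → ω c = ρ c := by
  intro c hc
  symm
  rw [← sub_eq_zero]
  refine eq_zero_of_approx fun ε hε => ?_
  obtain ⟨σ, ⟨φ, ⟨n, a, ha, ha'⟩, rfl⟩, h1⟩ := h ε hε 1 fun _ => c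
  have := h1 0
  have e : φ c = c := by
    rw [ha']
    have : ∀ i, star (a i) * c * a i = c * (star (a i) * a i) := fun i => by
      rw [← hc, mul_assoc]
    simp only [this]
    rw [← Finset.mul_sum, ha, mul_one]
  rwa [ContinuousLinearMap.comp_apply, e] at this

theorem backward (W : VecFun A) (hPI : PI A) (ω : A →L[ℂ] ℂ) (hω : St ω)
    (hJ : ∀ x ∈ SR A, ω x = 0) (ρ : A →L[ℂ] ℂ) (hρ : St ρ) (h : WSC (mixS ω) ρ) : WSC (mixS ρ) ω :=
  mix_approx W hPI ω ρ hω hρ hJ h.cent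

end Abstract

section Abstract
set_option linter.unusedSectionVars false
open Filter Topology
universe v
variable {A : Type v} [CStarAlgebra A] [PartialOrder A] [StarOrderedRing A]

theorem exists_max {I : Set A} (hI : CIdeal I) (h1 : (1 : A) ∉ I) : ∃ N, MIdeal N ∧ I ⊆ N := by
  obtain ⟨N, hIN, hN⟩ := zorn_subset_nonempty {I : Set A | CIdeal I ∧ (1 : A) ∉ I} (by
    intro c hc hch hne
    have dir : ∀ s ∈ c, ∀ t ∈ c, ∃ r ∈ c, s ⊆ r ∧ t ⊆ r := by
      intro s hs t ht
      rcases hch.total hs ht with h | h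
      · exact ⟨t, ht, h, subset_rfl⟩
      · exact ⟨s, hs, subset_rfl, h⟩
    have hcl : CIdeal (closure (⋃₀ c)) := by
      apply CIdeal.closure
      · obtain ⟨s, hs⟩ := hne
        exact ⟨s, hs, (hc hs).1.2.1⟩
      · rintro x ⟨s, hs, hx⟩ y ⟨t, ht, hy⟩
        obtain ⟨r, hr, h1, h2⟩ := dir s hs t ht
        exact ⟨r, hr, (hc hr).1.2.2.1 _ (h1 hx) _ (h2 hy)⟩
      · rintro a x ⟨s, hs, hx⟩
        exact ⟨s, hs, (hc hs).1.2.2.2.1 _ _ hx⟩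
      · rintro a x ⟨s, hs, hx⟩
        exact ⟨⟨s, hs, ((hc hs).1.2.2.2.2 _ _ hx).1⟩, ⟨s, hs, ((hc hs).1.2.2.2.2 _ _ hx).2⟩⟩
    refine ⟨closure (⋃₀ c), ⟨hcl, fun h => ?_⟩, fun s hs => (Set.subset_sUnion_of_mem hs).trans subset_closure⟩
    obtain ⟨d, ⟨s, hs, hd⟩, hdist⟩ := Metric.mem_closure_iff.1 h 1 one_pos
    rw [dist_eq_norm] at hdist
    have := isUnit_one_sub_of_norm_lt_one hdist
    rw [sub_sub_cancel] at this
    obtain ⟨u, rfl⟩ := this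
    apply (hc hs).2
    have := ((hc hs).1.2.2.2.2 (↑u⁻¹ : A) _ hd).1
    rwa [Units.inv_mul] at this) I ⟨hI, h1⟩
  refine ⟨N, ⟨hN.prop.1, ?_, ?_⟩, hIN⟩
  · rintro rfl
    exact hN.prop.2 trivial
  · intro N' h' hne hsub
    exact (hN.eq_of_subset ⟨h', h'.one_notMem hne⟩ hsub).symm

theorem cent_zero {w : A} (hw : Proj w) (hc : Cent w) (h : ∀ N, MIdeal N → w ∈ N) : w = 0 := by
  by_contra h0
  obtain ⟨N, hN, hsub⟩ := exists_max (I := {x : A | w * x = 0}) (by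
    refine ⟨isClosed_eq (by fun_prop) continuous_const, by simp, ?_, ?_, ?_⟩
    · intro x hx y hy
      simp only [Set.mem_ofPred_eq] at *
      rw [mul_add, hx, hy, add_zero]
    · intro c x hx
      simp only [Set.mem_ofPred_eq] at *
      rw [mul_smul_comm, hx, smul_zero]
    · intro a x hx
      simp only [Set.mem_ofPred_eq] at *
      refine ⟨?_, ?_⟩
      · rw [← mul_assoc, hc a, mul_assoc, hx, mul_zero]
      · rw [← mul_assoc, hx, zero_mul]) (by simpa using h0)
  have h1 : 1 - w ∈ N := hsub (by simp [mul_sub, hw.2])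
  have := hN.1.2.2.1 _ h1 _ (h N hN)
  rw [sub_add_cancel] at this
  exact hN.1.one_notMem hN.2.1 this

theorem compress_small (W : VecFun A) (hPI : PI A) (X : A) (hX : 0 ≤ X) (hXS : X ∈ SR A) (ε : ℝ)
    (hε : 0 < ε) : ∃ b : A, star b * b = 1 ∧ star b * X * b ≤ algebraMap ℝ A ε := by
  have hsa : IsSelfAdjoint (algebraMap ℝ A ε - X) :=
    (IsSelfAdjoint.algebraMap A (IsSelfAdjoint.all ε)).sub (IsSelfAdjoint.of_nonneg hX)
  obtain ⟨z, b, hz, hzc, hb, hpos, -, hN⟩ := good W hPI (algebraMap ℝ A ε - X)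
  have hN := hN hsa
  set y := algebraMap ℝ A ε - X with hy
  set w := 1 - z with hw
  have hwP : Proj w := hz.compl
  have hwC : Cent w := hzc.one_sub
  set k := w * (y⁺) + w * X with hk
  have hk0 : algebraMap ℝ A ε * w ≤ k := by
    have h1 : 0 ≤ w * (y⁺ + X - algebraMap ℝ A ε) := by
      apply cent_conj hwP hwC
      have := sub_nonneg.2 (CFC.le_posPart hsa)
      have e : y⁺ + X - algebraMap ℝ A ε = y⁺ - y := by rw [hy]; abel
      rw [e]
      exact this
    have e : w * (y⁺ + X - algebraMap ℝ A ε) = k - algebraMap ℝ A ε * w := by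
      rw [hk, ← hwC (algebraMap ℝ A ε), mul_sub, mul_add]
    rw [e] at h1
    exact sub_nonneg.1 h1
  have hwle : w ≤ ε⁻¹ • k := by
    have := smul_le_smul_of_nonneg_left hk0 (inv_pos.2 hε).le
    rwa [Algebra.algebraMap_eq_smul_one, smul_mul_assoc, one_mul, smul_smul, inv_mul_cancel₀ hε.ne', one_smul] at this
  obtain ⟨r, hr⟩ := invert (ε⁻¹ • k) w hwP hwC hwle (by
    rw [mul_smul_comm, hk, mul_add, ← mul_assoc, ← mul_assoc, hwP.2])
  have hw0 : w = 0 := by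
    apply cent_zero hwP hwC
    intro N hNm
    rw [← hr]
    have hkN : k ∈ N := hNm.1.2.2.1 _ (hN N hNm) _ (hNm.1.2.2.2.2 _ _ (Set.mem_sInter.1 hXS N hNm)).1
    have : ε⁻¹ • k ∈ N := by
      have := hNm.1.2.2.2.1 ((ε⁻¹ : ℝ) : ℂ) _ hkN
      rwa [Complex.coe_smul] at this
    exact (hNm.1.2.2.2.2 _ _ (hNm.1.2.2.2.2 _ _ this).1).2
  have hz1 : z = 1 := (sub_eq_zero.1 hw0).symm
  rw [hz1] at hb
  refine ⟨b, hb, ?_⟩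
  rw [hy, mul_sub, sub_mul, Algebra.algebraMap_eq_smul_one, mul_smul_comm, smul_mul_assoc, mul_one, hb, sub_nonneg] at hpos
  rwa [Algebra.algebraMap_eq_smul_one]

theorem compress_finset (W : VecFun A) (hPI : PI A) (ω : A →L[ℂ] ℂ) (hω : St ω) (F : Finset A)
    (ε : ℝ) (hε : 0 < ε) : ∃ b : A, star b * b = 1 ∧
      ∀ x ∈ F, x ∈ SR A → ‖ω (star b * x * b)‖ ^ 2 ≤ ε := by
  classical
  obtain ⟨b, hb, h⟩ := compress_small W hPI (∑ x ∈ F.filter (· ∈ SR A), star x * x)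
    (Finset.sum_nonneg fun x _ => star_mul_self_nonneg x) (by
      refine Set.mem_sInter.2 fun N hN => MIdeal.sum_mem hN.1 _ _ fun x hx => ?_
      exact (hN.1.2.2.2.2 _ _ (Set.mem_sInter.1 (Finset.mem_filter.1 hx).2 N hN)).1) ε hε
  refine ⟨b, hb, fun x hx hxS => ?_⟩
  refine (hω.conj_isom hb x).trans ?_
  have h1 : star x * x ≤ ∑ x ∈ F.filter (· ∈ SR A), star x * x :=
    Finset.single_le_sum (f := fun x => star x * x) (fun x _ => star_mul_self_nonneg x) (Finset.mem_filter.2 ⟨hx, hxS⟩)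
  have h2 := hω.mono ((star_left_conjugate_le_conjugate h1 b).trans h)
  rw [Algebra.algebraMap_eq_smul_one, ← Complex.coe_smul, map_smul, hω.2] at h2
  simpa using h2

theorem conjMap_norm {b : A} (hb : star b * b = 1) : ‖conjMap b‖ ≤ 1 := by
  have h1 : ‖b‖ ≤ 1 := norm_le_one_of_idem (by rw [hb, one_mul])
  refine ContinuousLinearMap.opNorm_le_bound _ zero_le_one fun x => ?_
  rw [conjMap_apply, one_mul]
  calc ‖star b * x * b‖ ≤ ‖star b‖ * ‖x‖ * ‖b‖ := (norm_mul_le _ _).trans (by gcongr; exact norm_mul_le _ _)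
    _ ≤ 1 * ‖x‖ * 1 := by gcongr; rwa [norm_star]
    _ = ‖x‖ := by ring

theorem forward (W : VecFun A) (hPI : PI A) (ω : A →L[ℂ] ℂ) (hω : St ω) :
    ∃ ρ : A →L[ℂ] ℂ, St ρ ∧ (∀ x ∈ SR A, ρ x = 0) ∧ WSC (mixS ω) ρ := by
  classical
  have hch : ∀ i : Finset A × ℕ, ∃ b : A, star b * b = 1 ∧
      ∀ x ∈ i.1, x ∈ SR A → ‖ω (star b * x * b)‖ ^ 2 ≤ 1 / ((i.2 : ℝ) + 1) :=
    fun i => compress_finset W hPI ω hω i.1 _ Nat.one_div_pos_of_nat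
  choose b hb hbx using hch
  let U : Ultrafilter (Finset A × ℕ) := Ultrafilter.of atTop
  let σ : Finset A × ℕ → A →L[ℂ] ℂ := fun i => ω.comp (conjMap (b i))
  have hσ : ∀ i, ‖σ i‖ ≤ ‖ω‖ := fun i =>
    (ContinuousLinearMap.opNorm_comp_le _ _).trans (by
      have := mul_le_mul_of_nonneg_left (conjMap_norm (hb i)) (norm_nonneg ω)
      rwa [mul_one] at this)
  obtain ⟨ρ', -, hρ'⟩ := (WeakDual.isCompact_closedBall (𝕜 := ℂ) (0 : StrongDual ℂ A) ‖ω‖).ultrafilter_le_nhds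
    (U.map fun i => StrongDual.toWeakDual (σ i)) (by
      rw [Ultrafilter.coe_map, le_principal_iff, mem_map]
      refine Filter.univ_mem' fun i => ?_
      simpa using hσ i)
  let ρ : A →L[ℂ] ℂ := WeakDual.toStrongDual ρ'
  have hlim : ∀ x, Tendsto (fun i => σ i x) U (𝓝 (ρ x)) := by
    intro x
    have h1 : Tendsto (fun i => StrongDual.toWeakDual (σ i)) U (𝓝 ρ') := hρ'
    exact ((WeakDual.eval_continuous x).tendsto ρ').comp h1
  have hU : (U : Filter (Finset A × ℕ)) ≤ atTop := Ultrafilter.of_le _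
  have hst : ∀ i, St (σ i) := by
    intro i
    refine ⟨fun a => ?_, ?_⟩
    · have : star (b i) * (star a * a) * b i = star (a * b i) * (a * b i) := by simp [mul_assoc]
      simp only [σ, ContinuousLinearMap.comp_apply, conjMap_apply, this]
      exact hω.1 _
    · simp only [σ, ContinuousLinearMap.comp_apply, conjMap_apply, mul_one, hb, hω.2]
  refine ⟨ρ, ⟨fun a => ?_, ?_⟩, ?_, ?_⟩
  · exact ge_of_tendsto (hlim _) (Eventually.of_forall fun i => (hst i).1 a)
  · refine tendsto_nhds_unique (hlim 1) ?_
    simp only [fun i => (hst i).2]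
    exact tendsto_const_nhds
  · intro x hx
    have h1 : Tendsto (fun i => ‖σ i x‖ ^ 2) U (𝓝 (‖ρ x‖ ^ 2)) := ((hlim x).norm).pow 2
    have h2 : Tendsto (fun i : Finset A × ℕ => 1 / ((i.2 : ℝ) + 1)) U (𝓝 0) := by
      have : Tendsto (fun i : Finset A × ℕ => i.2) atTop atTop := by
        rw [← prod_atTop_atTop_eq]
        exact tendsto_snd
      exact (tendsto_one_div_add_atTop_nhds_zero_nat.comp this).mono_left hU
    have h3 : ‖ρ x‖ ^ 2 ≤ 0 := by
      refine le_of_tendsto_of_tendsto h1 h2 ?_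
      have : ∀ᶠ i : Finset A × ℕ in atTop, ({x}, 0) ≤ i := eventually_ge_atTop _
      filter_upwards [hU this] with i hi
      have := hbx i x (hi.1 (Finset.mem_singleton_self x)) hx
      simpa [σ, conjMap_apply] using this
    have := le_antisymm h3 (sq_nonneg _)
    simpa using this
  · intro ε hε n x
    have : ∀ᶠ i in (U : Filter (Finset A × ℕ)), ∀ j, ‖ρ (x j) - σ i (x j)‖ < ε := by
      rw [eventually_all]
      intro j
      have h := (Metric.tendsto_nhds.1 (hlim (x j))) ε hε
      filter_upwards [h] with i hi
      rwa [dist_comm, dist_eq_norm] at hi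
    obtain ⟨i, hi⟩ := this.exists
    exact ⟨σ i, ⟨_, EU_conj (hb i), rfl⟩, hi⟩

theorem abstract_main (W : VecFun A) (hPI : PI A) (ω : A →L[ℂ] ℂ) (hω : St ω) :
    (∀ ρ : A →L[ℂ] ℂ, St ρ → WSC (mixS ω) ρ → WSC (mixS ρ) ω) ↔ ∀ x ∈ SR A, ω x = 0 := by
  constructor
  · intro h
    obtain ⟨ρ, h1, h2, h3⟩ := forward W hPI ω hω
    exact (h ρ h1 h3).vanish h2
  · exact fun hJ ρ hρ h => backward W hPI ω hω hJ ρ hρ h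

end Abstract


section Concrete
open Filter Topology

theorem vn_mem_iff (M : VonNeumannAlgebra H) (z : H →L[ℂ] H) :
    z ∈ M ↔ ∀ g ∈ M.commutant, g * z = z * g := by
  conv_lhs => rw [← M.commutant_commutant]
  rw [VonNeumannAlgebra.mem_commutant_iff]

theorem vn_isClosed (M : VonNeumannAlgebra H) : IsClosed (M : Set (H →L[ℂ] H)) := by
  have : (M : Set (H →L[ℂ] H)) = ⋂ g ∈ M.commutant, {z | g * z = z * g} := by
    ext z
    simp [vn_mem_iff M z]
  rw [this]
  exact isClosed_biInter fun g _ => isClosed_eq (by fun_prop) (by fun_prop)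

@[reducible] def vnCStarAlgebra (M : VonNeumannAlgebra H) : CStarAlgebra ↥M where
  complete := (vn_isClosed M).completeSpace_coe.complete
  norm_mul_self_le x := CStarRing.norm_mul_self_le (x : H →L[ℂ] H)
  star_smul r x := Subtype.ext (star_smul r (x : H →L[ℂ] H))

attribute [local instance] vnCStarAlgebra

theorem neg_test {A : Type*} [CStarAlgebra A] [PartialOrder A] [StarOrderedRing A] (y : A)
    (hsa : IsSelfAdjoint y) :
    ∃ n c : A, star n * y * n = - (star c * c) ∧ (c = 0 → 0 ≤ y) := by
  set n := y⁻ with hn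
  have hn0 : 0 ≤ n := CFC.negPart_nonneg y
  have hns : star n = n := (IsSelfAdjoint.of_nonneg hn0).star_eq
  set r := CFC.sqrt n with hr
  have hrr : r * r = n := CFC.sqrt_mul_sqrt_self _ hn0
  have hrs : star r = r := (IsSelfAdjoint.of_nonneg (CFC.sqrt_nonneg _)).star_eq
  refine ⟨n, r * n, ?_, fun hrn => ?_⟩
  · rw [star_mul, hns, hrs]
    have e : y = y⁺ - n := (CFC.posPart_sub_negPart y hsa).symm
    have e2 : n * y⁺ = 0 := CFC.negPart_mul_posPart y
    have e3 : n * y = -(n * n) := by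
      nth_rw 1 [e]
      rw [mul_sub, e2, zero_sub]
    rw [e3, mul_assoc n r, ← mul_assoc r r, hrr, neg_mul, mul_assoc]
  · have hnn : n * n = 0 := by
      nth_rw 1 [← hrr]
      rw [mul_assoc, hrn, mul_zero]
    have hn00 : n = 0 := star_mul_self_zero (by rw [hns, hnn])
    rw [← CFC.posPart_sub_negPart y hsa, ← hn, hn00, sub_zero]
    exact CFC.posPart_nonneg y

theorem vn_adj (x : ↥M) (ξ η : H) :
    ⟪(x : H →L[ℂ] H) ξ, η⟫ = ⟪ξ, ((star x : ↥M) : H →L[ℂ] H) η⟫ :=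
  (ContinuousLinearMap.adjoint_inner_right (x : H →L[ℂ] H) ξ η).symm

theorem vn_test (y n c : ↥M) (h : ∀ ξ : H, 0 ≤ ⟪ξ, (y : H →L[ℂ] H) ξ⟫)
    (hyn : star n * y * n = - (star c * c)) : c = 0 := by
  apply Subtype.ext
  ext ξ
  have h1 := h ((n : H →L[ℂ] H) ξ)
  rw [vn_adj n] at h1
  have h2 : ((star n : ↥M) : H →L[ℂ] H) ((y : H →L[ℂ] H) ((n : H →L[ℂ] H) ξ)) =
    ((star n * y * n : ↥M) : H →L[ℂ] H) ξ := rfl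
  rw [h2, hyn] at h1
  have h3 : ((-(star c * c) : ↥M) : H →L[ℂ] H) ξ =
    - (((star c : ↥M) : H →L[ℂ] H) ((c : H →L[ℂ] H) ξ)) := rfl
  rw [h3, inner_neg_right, ← vn_adj, inner_self_eq_norm_sq_to_K] at h1
  have h4 : ‖(c : H →L[ℂ] H) ξ‖ ^ 2 ≤ 0 := by
    have h6 : (0 : ℂ) ≤ ((-(‖(c : H →L[ℂ] H) ξ‖ ^ 2) : ℝ) : ℂ) := by
      push_cast
      exact h1
    have := Complex.zero_le_real.1 h6
    linarith
  have h5 : ‖(c : H →L[ℂ] H) ξ‖ = 0 := by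
    have := le_antisymm h4 (sq_nonneg _)
    simpa using this
  simpa using norm_eq_zero.1 h5

theorem vn_sa (y : ↥M) (h : ∀ ξ : H, 0 ≤ ⟪ξ, (y : H →L[ℂ] H) ξ⟫) : IsSelfAdjoint y := by
  have h1 : IsSelfAdjoint (y : H →L[ℂ] H) := by
    rw [ContinuousLinearMap.isSelfAdjoint_iff_isSymmetric, LinearMap.isSymmetric_iff_inner_map_self_real]
    intro v
    have h2 : (starRingEnd ℂ) ⟪v, (y : H →L[ℂ] H) v⟫ = ⟪v, (y : H →L[ℂ] H) v⟫ :=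
      Complex.conj_eq_iff_im.2 (Complex.le_def.1 (h v)).2.symm
    rw [inner_conj_symm] at h2
    show (starRingEnd ℂ) ⟪(y : H →L[ℂ] H) v, v⟫ = ⟪(y : H →L[ℂ] H) v, v⟫
    rw [inner_conj_symm, h2]
  exact Subtype.ext h1.star_eq

theorem vn_cpt (M : VonNeumannAlgebra H) (U : Ultrafilter ↥M) (r : ℝ)
    (hU : ∀ᶠ a in (U : Filter ↥M), ‖a‖ ≤ r) :
    ∃ y : ↥M, ∀ ξ η : H, Tendsto (fun a : ↥M => ⟪ξ, (a : H →L[ℂ] H) η⟫) U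
      (𝓝 ⟪ξ, (y : H →L[ℂ] H) η⟫) := by
  have hbd : ∀ ξ η : H, ∀ᶠ a : ↥M in (U : Filter ↥M), ‖⟪ξ, (a : H →L[ℂ] H) η⟫‖ ≤ r * ‖ξ‖ * ‖η‖ := by
    intro ξ η
    filter_upwards [hU] with a ha
    have ha' : ‖(a : H →L[ℂ] H)‖ ≤ r := ha
    calc ‖⟪ξ, (a : H →L[ℂ] H) η⟫‖ ≤ ‖ξ‖ * ‖(a : H →L[ℂ] H) η‖ := norm_inner_le_norm _ _
      _ ≤ ‖ξ‖ * (r * ‖η‖) := by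
        gcongr
        exact ((a : H →L[ℂ] H).le_opNorm η).trans (by gcongr)
      _ = _ := by ring
  have hex : ∀ ξ η : H, ∃ l : ℂ, Tendsto (fun a : ↥M => ⟪ξ, (a : H →L[ℂ] H) η⟫) U (𝓝 l) := by
    intro ξ η
    obtain ⟨l, -, hl⟩ := (isCompact_closedBall (0 : ℂ) (r * ‖ξ‖ * ‖η‖)).ultrafilter_le_nhds
      (U.map fun a : ↥M => ⟪ξ, (a : H →L[ℂ] H) η⟫) (by
        rw [Ultrafilter.coe_map, le_principal_iff, mem_map]
        filter_upwards [hbd ξ η] with a ha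
        simpa using ha)
    exact ⟨l, hl⟩
  choose L hL using hex
  have hLn : ∀ ξ η, ‖L ξ η‖ ≤ r * ‖ξ‖ * ‖η‖ := fun ξ η => le_of_tendsto (hL ξ η).norm (hbd ξ η)
  let B0 : H →ₗ⋆[ℂ] H →ₗ[ℂ] ℂ := LinearMap.mk₂'ₛₗ (starRingEnd ℂ) (RingHom.id ℂ) L
    (fun ξ ξ' η => tendsto_nhds_unique (hL _ _) (by
      simp only [inner_add_left]
      exact (hL _ _).add (hL _ _)))
    (fun c ξ η => tendsto_nhds_unique (hL _ _) (by
      simp only [inner_smul_left]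
      exact (hL _ _).const_mul _))
    (fun ξ η η' => tendsto_nhds_unique (hL _ _) (by
      simp only [map_add, inner_add_right]
      exact (hL _ _).add (hL _ _)))
    (fun c ξ η => tendsto_nhds_unique (hL _ _) (by
      simp only [map_smul, inner_smul_right]
      exact (hL _ _).const_mul _))
  let B : H →L⋆[ℂ] H →L[ℂ] ℂ := LinearMap.mkContinuous₂ B0 r hLn
  let y : H →L[ℂ] H := ContinuousLinearMap.adjoint (InnerProductSpace.continuousLinearMapOfBilin B)
  have hy : ∀ ξ η, ⟪ξ, y η⟫ = L ξ η := by
    intro ξ η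
    rw [ContinuousLinearMap.adjoint_inner_right, InnerProductSpace.continuousLinearMapOfBilin_apply]
    rfl
  have hyM : y ∈ M := by
    rw [vn_mem_iff]
    intro g hg
    ext η
    refine ext_inner_left ℂ fun ξ => ?_
    simp only [mul_apply_eq_comp]
    rw [← ContinuousLinearMap.adjoint_inner_left, hy, hy]
    refine tendsto_nhds_unique (hL _ _) ?_
    refine (hL ξ (g η)).congr fun a => ?_
    rw [ContinuousLinearMap.adjoint_inner_left]
    have := (vn_mem_iff M (a : H →L[ℂ] H)).1 a.2 g hg
    have := congrArg (fun T : H →L[ℂ] H => T η) this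
    simp only [mul_apply_eq_comp] at this
    rw [this]
  exact ⟨⟨y, hyM⟩, fun ξ η => by
    simp only [hy]
    exact hL ξ η⟩

/-- the vector functionals of a von Neumann algebra -/
def vnVecFun (M : VonNeumannAlgebra H) :
    @VecFun ↥M (vnCStarAlgebra M) (CStarAlgebra.spectralOrder ↥M) :=
  letI := CStarAlgebra.spectralOrder ↥M
  { V := {ψ | ∃ ξ η : H, ψ = fun x : ↥M => ⟪ξ, (x : H →L[ℂ] H) η⟫}
    sep := by
      intro x y h
      apply Subtype.ext
      ext η
      exact ext_inner_left ℂ fun ξ => h _ ⟨ξ, η, rfl⟩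
    mulL := by
      rintro _ ⟨ξ, η, rfl⟩ a
      refine ⟨ContinuousLinearMap.adjoint (a : H →L[ℂ] H) ξ, η, ?_⟩
      ext x
      rw [ContinuousLinearMap.adjoint_inner_left]
      rfl
    mulR := by
      rintro _ ⟨ξ, η, rfl⟩ a
      exact ⟨ξ, (a : H →L[ℂ] H) η, rfl⟩
    star' := by
      rintro _ ⟨ξ, η, rfl⟩
      refine ⟨η, ξ, ?_⟩
      ext x
      rw [inner_conj_symm]
      exact ContinuousLinearMap.adjoint_inner_left (x : H →L[ℂ] H) ξ η
    cont := by
      rintro _ ⟨ξ, η, rfl⟩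
      have : Continuous fun x : ↥M => (x : H →L[ℂ] H) := continuous_subtype_val
      fun_prop
    pos := by
      intro y h
      haveI := CStarAlgebra.spectralOrderedRing ↥M
      have h' : ∀ ξ : H, 0 ≤ ⟪ξ, (y : H →L[ℂ] H) ξ⟫ := by
        refine fun ξ => h _ ⟨ξ, ξ, rfl⟩ fun a ha => ?_
        obtain ⟨b, rfl⟩ := CStarAlgebra.nonneg_iff_eq_star_mul_self.1 ha
        have : ⟪ξ, ((star b * b : ↥M) : H →L[ℂ] H) ξ⟫ = ⟪(b : H →L[ℂ] H) ξ, (b : H →L[ℂ] H) ξ⟫ :=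
          ContinuousLinearMap.adjoint_inner_right (b : H →L[ℂ] H) ξ _
        simp only [this]
        rw [inner_self_eq_norm_sq_to_K]
        have h6 : (0 : ℂ) ≤ ((‖(b : H →L[ℂ] H) ξ‖ ^ 2 : ℝ) : ℂ) := Complex.zero_le_real.2 (sq_nonneg _)
        push_cast at h6
        exact h6
      obtain ⟨n, c, h1, h2⟩ := neg_test y (vn_sa y h')
      exact h2 (vn_test y n c h' h1)
    cpt := by
      intro U r hU
      obtain ⟨y, hy⟩ := vn_cpt M U r hU
      exact ⟨y, by
        rintro _ ⟨ξ, η, rfl⟩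
        exact hy ξ η⟩ }

theorem vn_PI (hpi : ProperlyInfinite M) : PI ↥M := by
  intro p hp hc hf
  refine hpi p ⟨?_, hp.1, hp.2⟩ ⟨hp.1, hp.2, hf⟩
  rw [Semigroup.mem_center_iff]
  exact fun a => (hc a).symm

end Concrete

/-- **Corollary.** On a properly infinite von Neumann algebra, a state is
maximally mixed if and only if it vanishes on the strong radical. -/
theorem properlyInfinite_maximallyMixed_iff
    (hpi : ProperlyInfinite M) (ω : ↥M →L[ℂ] ℂ) (hω : IsState ω) :
    IsMaximallyMixed ω ↔ ∀ x ∈ strongRadical M, ω x = 0 := by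
  letI := vnCStarAlgebra M
  letI := CStarAlgebra.spectralOrder ↥M
  haveI := CStarAlgebra.spectralOrderedRing ↥M
  have h := abstract_main (vnVecFun M) (vn_PI hpi) ω hω
  exact ⟨fun hm => h.1 hm.2, fun hJ => ⟨hω, h.2 hJ⟩⟩

end VonNeumannAlgebraPaper

end
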